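/- Let N ≥ 1, k ≥ 2, let s be the largest divisor of 24 such that s² divides N, and let w ∈ {1, −1}. Let f be a cusp form of weight k on Γ₀(N) such that: (a) {γ ∈ SL₂(ℤ) : f|_k γ = f} = Γ₀(N); (b) f|_k W_N = w·f, where (f|_k W_N)(τ) = N^{−k/2} τ^{−k} f(−1/(Nτ)); (c) there exists n₀ ≥ 1 coprime to s with a_{n₀}(f) a nonzero rational number; and (d) for every field automorphism σ of ℂ there is a cusp form f_σ of weight k on Γ₀(N) with a_n(f_σ) = σ(a_n(f)) for all n ≥ 1, satisfying {γ ∈ SL₂(ℤ) : f_σ|_k γ = f_σ} = Γ₀(N) and f_σ|_k W_N = w·f_σ. Then for every g = (A, B; C, D) ∈ SL₂(ℤ), the subfield of ℂ generated by the Fourier coefficients of f|_k g (in its expansion Σ_{n≥0} c_n e^{2πinτ/N}) is equal to K_f(ζ_{N'}), where N' = N/gcd(CD, N). -/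

import Mathlib

open Complex UpperHalfPlane CongruenceSubgroup
open scoped ModularForm MatrixGroups Real

noncomputable section

/-- `ζ_N = e^{2πi/N}`. -/
def zetaC (N : ℕ) : ℂ := Complex.exp (2 * Real.pi * Complex.I / N)

/-- `f` has the Fourier expansion `Σ_{n ≥ 0} c n · e^{2πinτ/N}`. -/
def HasExpansion (N : ℕ) (f : ℍ → ℂ) (c : ℕ → ℂ) : Prop :=
  ∀ τ : ℍ, HasSum (fun n : ℕ => c n * Complex.exp (2 * Real.pi * Complex.I * n * (τ : ℂ) / N)) (f τ)

/-- `F` is an eigenvector of the Fricke involution `W_N` with eigenvalue `w`: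
`N^{−k/2} τ^{−k} F(−1/(Nτ)) = w·F(τ)`. -/
def FrickeEigen (N : ℕ) (k : ℤ) (F : ℍ → ℂ) (w : ℂ) : Prop :=
  ∀ τ τ' : ℍ, (τ' : ℂ) = -1 / ((N : ℂ) * (τ : ℂ)) →
    (Real.sqrt N : ℂ) ^ (-k) * (τ : ℂ) ^ (-k) * F τ' = w * F τ

section Part1

lemma qpow (N : ℕ) (n : ℕ) (τ : ℂ) :
    Complex.exp (2 * Real.pi * Complex.I * n * τ / N) = Function.Periodic.qParam (N : ℝ) τ ^ n := by
  rw [Function.Periodic.qParam, ← Complex.exp_nat_mul]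
  congr 1
  push_cast
  ring

lemma hasExpansion_iff (N : ℕ) (F : ℍ → ℂ) (c : ℕ → ℂ) :
    HasExpansion N F c ↔ ∀ τ : ℍ, HasSum (fun n => c n • Function.Periodic.qParam (N : ℝ) (τ : ℂ) ^ n) (F τ) := by
  unfold HasExpansion
  simp only [qpow, smul_eq_mul]

/-- any nonzero `q` in the unit disc comes from `ℍ` -/
lemma exists_qParam (N : ℕ) [NeZero N] (q : ℂ) (hq0 : q ≠ 0) (hq : ‖q‖ < 1) :
    ∃ τ : ℍ, Function.Periodic.qParam (N : ℝ) (τ : ℂ) = q := by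
  have hN : (0:ℝ) < N := by exact_mod_cast Nat.pos_of_neZero N
  refine ⟨⟨Function.Periodic.invQParam (N:ℝ) q, ?_⟩, ?_⟩
  · exact Function.Periodic.im_invQParam_pos_of_norm_lt_one hN hq hq0
  · exact Function.Periodic.qParam_right_inv hN.ne' hq0

lemma hasExpansion_pow (N : ℕ) [NeZero N] (F : ℍ → ℂ) (c : ℕ → ℂ) (h : HasExpansion N F c) :
    HasFPowerSeriesOnBall (FormalMultilinearSeries.ofScalars ℂ c).sum
      (FormalMultilinearSeries.ofScalars ℂ c) 0 1 ∧
    ∀ τ : ℍ, F τ = (FormalMultilinearSeries.ofScalars ℂ c).sum (Function.Periodic.qParam (N : ℝ) (τ : ℂ)) := by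
  rw [hasExpansion_iff] at h
  have hr : 1 ≤ (FormalMultilinearSeries.ofScalars ℂ c).radius := by
    refine ENNReal.le_of_forall_nnreal_lt fun r hr ↦ ?_
    rcases eq_or_ne r 0 with rfl | hr0
    · simp
    refine FormalMultilinearSeries.le_radius_of_summable_norm _ ?_
    have hr1 : (r : ℝ) < 1 := by exact_mod_cast hr
    obtain ⟨τ, hτ⟩ := exists_qParam N (r : ℂ) (by exact_mod_cast hr0) (by simpa using hr1)
    have := (h τ).summable.norm
    rw [hτ] at this
    refine this.congr fun n => ?_
    simp
  have h1 := FormalMultilinearSeries.hasFPowerSeriesOnBall (FormalMultilinearSeries.ofScalars ℂ c)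
    (lt_of_lt_of_le zero_lt_one hr)
  refine ⟨h1.mono zero_lt_one hr, fun τ => ?_⟩
  rw [← (h τ).tsum_eq]
  simp [FormalMultilinearSeries.sum, mul_comm]

lemma hasExpansion_unique (N : ℕ) [NeZero N] {F : ℍ → ℂ} {c c' : ℕ → ℂ} (h : HasExpansion N F c)
    (h' : HasExpansion N F c') : c = c' := by
  obtain ⟨h1, e1⟩ := hasExpansion_pow N F c h
  obtain ⟨h2, e2⟩ := hasExpansion_pow N F c' h'
  have hev : (FormalMultilinearSeries.ofScalars ℂ c).sum =ᶠ[nhdsWithin 0 {0}ᶜ]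
      (FormalMultilinearSeries.ofScalars ℂ c').sum := by
    have : Metric.ball (0:ℂ) 1 ∈ nhdsWithin (0:ℂ) {0}ᶜ :=
      nhdsWithin_le_nhds (Metric.ball_mem_nhds _ one_pos)
    filter_upwards [this, self_mem_nhdsWithin] with q hq hq0
    obtain ⟨τ, hτ⟩ := exists_qParam N q hq0 (by simpa using hq)
    rw [← hτ, ← e1, ← e2]
  have hev2 := (h1.hasFPowerSeriesAt.continuousAt.eventuallyEq_nhds_iff_eventuallyEq_nhdsNE
    h2.hasFPowerSeriesAt.continuousAt).mp hev
  have := (h1.hasFPowerSeriesAt.congr hev2).eq_formalMultilinearSeries h2.hasFPowerSeriesAt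
  ext n
  simpa using congr_arg (FormalMultilinearSeries.coeff · n) this

lemma hasExpansion_fun_unique (N : ℕ) {F F' : ℍ → ℂ} {c : ℕ → ℂ} (h : HasExpansion N F c)
    (h' : HasExpansion N F' c) : F = F' := by
  ext τ
  exact (h τ).unique (h' τ)

lemma hasExpansion_mdiff (N : ℕ) [NeZero N] {F : ℍ → ℂ} {c : ℕ → ℂ} (h : HasExpansion N F c) :
    MDifferentiable (modelWithCornersSelf ℂ ℂ) (modelWithCornersSelf ℂ ℂ) F := by
  obtain ⟨h1, e1⟩ := hasExpansion_pow N F c h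
  rw [UpperHalfPlane.mdifferentiable_iff]
  have hN : (0:ℝ) < N := by exact_mod_cast Nat.pos_of_neZero N
  have hd : DifferentiableOn ℂ (fun z : ℂ => (FormalMultilinearSeries.ofScalars ℂ c).sum
      (Function.Periodic.qParam (N : ℝ) z)) {z | 0 < z.im} := by
    refine DifferentiableOn.comp (g := (FormalMultilinearSeries.ofScalars ℂ c).sum) (t := Metric.ball (0:ℂ) 1) ?_ ?_ ?_
    · have := h1.differentiableOn
      rw [← Metric.eball_ofReal]
      simpa using this
    · exact (Function.Periodic.differentiable_qParam).differentiableOn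
    · intro z hz
      simpa using Function.Periodic.norm_qParam_lt_one hN hz
  refine hd.congr fun z hz => ?_
  rw [Function.comp_apply, e1, ofComplex_apply_of_im_pos hz]

lemma hasExpansion_bdd (N : ℕ) [NeZero N] {F : ℍ → ℂ} {c : ℕ → ℂ} (h : HasExpansion N F c) :
    IsBoundedAtImInfty F :=
  isBoundedAtImInfty_of_hasSum_qExpansion (h := N) (by exact_mod_cast Nat.pos_of_neZero N) ((hasExpansion_iff _ _ _).mp h)

lemma hasExpansion_zero_coeff (N : ℕ) [NeZero N] {F : ℍ → ℂ} {c : ℕ → ℂ} (h : HasExpansion N F c)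
    (hF : IsZeroAtImInfty F) : c 0 = 0 := by
  obtain ⟨h1, e1⟩ := hasExpansion_pow N F c h
  have hN : (0:ℝ) < N := by exact_mod_cast Nat.pos_of_neZero N
  have ht := h1.hasFPowerSeriesAt.continuousAt.tendsto.comp (qParam_tendsto_atImInfty hN)
  have h2 := tendsto_nhds_unique (hF : Filter.Tendsto F _ _) (ht.congr fun τ => (e1 τ).symm)
  rw [h2]
  simp [FormalMultilinearSeries.sum, zero_pow_eq]

/-- pairs (function, formal `q`-expansion) -/
def expRing (N : ℕ) : Subring ((ℍ → ℂ) × PowerSeries ℂ) where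
  carrier := {p | HasExpansion N p.1 (fun n => PowerSeries.coeff n p.2)}
  mul_mem' := by
    intro p p' h h' τ
    have s1 := (h τ).summable.norm
    have s2 := (h' τ).summable.norm
    have h3 : Summable (fun n : ℕ => (PowerSeries.coeff n (p * p').2) * Complex.exp (2 * Real.pi * Complex.I * n * (τ : ℂ) / N)) ∧
        ∑' n : ℕ, (PowerSeries.coeff n (p * p').2) * Complex.exp (2 * Real.pi * Complex.I * n * (τ : ℂ) / N) = p.1 τ * p'.1 τ := by
      have e := tsum_mul_tsum_eq_tsum_sum_antidiagonal_of_summable_norm s1 s2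
      have s := (summable_norm_sum_mul_antidiagonal_of_summable_norm s1 s2).of_norm
      have key : ∀ n : ℕ, ∑ kl ∈ Finset.HasAntidiagonal.antidiagonal n,
          (PowerSeries.coeff kl.1 p.2 * Complex.exp (2 * Real.pi * Complex.I * kl.1 * (τ : ℂ) / N)) *
          (PowerSeries.coeff kl.2 p'.2 * Complex.exp (2 * Real.pi * Complex.I * kl.2 * (τ : ℂ) / N)) =
          (PowerSeries.coeff n (p * p').2) * Complex.exp (2 * Real.pi * Complex.I * n * (τ : ℂ) / N) := by
        intro n
        rw [Prod.snd_mul, PowerSeries.coeff_mul, Finset.sum_mul]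
        refine Finset.sum_congr rfl fun x hx => ?_
        rw [Finset.HasAntidiagonal.mem_antidiagonal] at hx
        simp only [qpow]
        rw [← hx, pow_add]
        ring
      simp_rw [key] at e s
      refine ⟨s, ?_⟩
      rw [← e, (h τ).tsum_eq, (h' τ).tsum_eq]
    exact h3.1.hasSum_iff.mpr h3.2
  one_mem' := by
    intro τ
    have := hasSum_single (f := fun n : ℕ => (PowerSeries.coeff n (1 : (ℍ → ℂ) × PowerSeries ℂ).2) * Complex.exp (2 * Real.pi * Complex.I * n * (τ : ℂ) / N)) 0 (by
      intro b hb
      simp [PowerSeries.coeff_one, hb])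
    simpa using this
  add_mem' := by
    intro p p' h h' τ
    simpa [add_mul] using (h τ).add (h' τ)
  zero_mem' := by
    intro τ
    simp [hasSum_zero]
  neg_mem' := by
    intro p h τ
    simpa using (h τ).neg

lemma mem_expRing {N : ℕ} {p : (ℍ → ℂ) × PowerSeries ℂ} :
  p ∈ expRing N ↔ HasExpansion N p.1 (fun n => PowerSeries.coeff n p.2) := Iff.rfl

/-- a level one form has an expansion in `q^{1/N}` -/
def pexp (N : ℕ) (p : PowerSeries ℂ) : PowerSeries ℂ :=
  PowerSeries.mk fun n => if N ∣ n then PowerSeries.coeff (n / N) p else 0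

lemma hasExpansion_dilate (M N d : ℕ) (hd : 0 < d) {F G : ℍ → ℂ} {c : ℕ → ℂ} (h : HasExpansion M F c)
    (u : ℂ) (φ : ℍ → ℍ) (ζ : ℂ) (hG : ∀ τ, G τ = u * F (φ τ))
    (hφ : ∀ τ : ℍ, Function.Periodic.qParam (M : ℝ) (φ τ) = ζ * Function.Periodic.qParam (N : ℝ) τ ^ d) :
    HasExpansion N G (fun n => if d ∣ n then u * c (n / d) * ζ ^ (n / d) else 0) := by
  rw [hasExpansion_iff] at h ⊢
  intro τ
  have h1 := (h (φ τ)).mul_left u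
  rw [← hG] at h1
  have hinj : Function.Injective (fun n : ℕ => d * n) := fun a b hab => by
    simpa [hd.ne'] using hab
  have := (hinj.hasSum_iff (f := fun n => (if d ∣ n then u * c (n / d) * ζ ^ (n / d) else 0) • Function.Periodic.qParam (N : ℝ) (τ : ℂ) ^ n) (a := G τ) ?_).mp ?_
  · exact this
  · intro n hn
    have : ¬ d ∣ n := fun ⟨m, hm⟩ => hn ⟨m, hm.symm⟩
    simp [this]
  · refine h1.congr_fun fun n => ?_
    simp only [Function.comp_apply, dvd_mul_right, if_true, Nat.mul_div_cancel_left _ hd]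
    rw [hφ, mul_pow, ← pow_mul]
    simp only [smul_eq_mul]; ring

end Part1

section Part2

open EisensteinSeries ModularForm in
lemma E_rat {k : ℕ} (hk : 3 ≤ k) (hk2 : Even k) (σ : ℂ ≃+* ℂ) :
    PowerSeries.map (σ : ℂ →+* ℂ) (qExpansion 1 (E hk)) = qExpansion 1 (E hk) := by
  ext n
  rw [PowerSeries.coeff_map, E_qExpansion_coeff hk hk2]
  have h2 : σ 2 = 2 := map_ofNat σ 2
  split_ifs <;> simp [h2]

open EisensteinSeries ModularForm in
lemma Delta_rat (σ : ℂ ≃+* ℂ) :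
    PowerSeries.map (σ : ℂ →+* ℂ) (qExpansion 1 discriminant) = qExpansion 1 discriminant := by
  have h : (1728 : ℂ) • qExpansion 1 discriminant = qExpansion 1 E₄ ^ 3 - qExpansion 1 E₆ ^ 2 := by
    have h1 : ((1728 : ℂ) • CuspForm.discriminant : ℍ → ℂ) =
      ⇑(ModularForm.mcast (by decide) (E₄.pow 3) - ModularForm.mcast (by decide) (E₆.pow 2) : ModularForm 𝒮ℒ 12) := by
      ext z
      have := discriminant_eq_E₄_cube_sub_E₆_sq z
      simp only [Pi.smul_apply, smul_eq_mul, coe_mcast, coe_pow, sub_apply, Pi.pow_apply, CuspForm.coe_discriminant]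
      rw [this]; ring
    have h2 := ModularForm.qExpansion_smul one_pos one_mem_strictPeriods_SL (1728:ℂ)
      CuspForm.discriminant
    rw [h1] at h2
    rw [CuspForm.coe_discriminant] at h2
    rw [← h2]
    simp only [FunLike.coe_sub, coe_mcast,
      ModularForm.qExpansion_sub one_pos one_mem_strictPeriods_SL,
      ModularForm.qExpansion_pow one_pos one_mem_strictPeriods_SL]
  have h' : qExpansion 1 discriminant = PowerSeries.C (1728⁻¹ : ℂ) * (qExpansion 1 E₄ ^ 3 - qExpansion 1 E₆ ^ 2) := by
    rw [← h, ← PowerSeries.smul_eq_C_mul, smul_smul]; norm_num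
  rw [h']
  simp only [map_mul, map_sub, map_pow, PowerSeries.map_C]
  rw [E_rat _ (by decide) σ, E_rat _ (by decide) σ]
  have h2 : σ 1728 = 1728 := map_ofNat σ 1728
  simp [h2]

open EisensteinSeries ModularForm in
/-- level one forms are stable under automorphisms of `ℂ`. -/
lemma levelOne_conj_nat (σ : ℂ ≃+* ℂ) (m : ℕ) : ∀ (k : ℤ), k < m → ∀ (h : ModularForm 𝒮ℒ k),
    ∃ h' : ModularForm 𝒮ℒ k, qExpansion 1 h' = PowerSeries.map (σ : ℂ →+* ℂ) (qExpansion 1 h) := by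
  induction m with
  | zero =>
    intro k hk h
    refine ⟨0, ?_⟩
    rw [ModularFormClass.levelOne_neg_weight_eq_zero (by simpa using hk) h]
    simp [qExpansion_zero]
  | succ m ih =>
    intro k hk h
    by_cases hkm : k < m
    · exact ih k hkm h
    obtain rfl : k = m := by push_cast at hk; omega
    have cuspcase : ∀ h : ModularForm 𝒮ℒ (m:ℤ), (qExpansion 1 h).coeff 0 = 0 →
        ∃ h' : ModularForm 𝒮ℒ (m:ℤ), qExpansion 1 h' = PowerSeries.map (σ : ℂ →+* ℂ) (qExpansion 1 h) := by
      intro h h0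
      obtain ⟨h2, hh2⟩ := ih (m - 12) (by omega) (CuspForm.discriminantEquiv (toCuspForm h h0))
      refine ⟨(CuspForm.ofMulDiscriminant h2).toModularFormₗ, ?_⟩
      rw [qExpansion_eq_qExpansion_discriminant_mul h h0, map_mul, ← hh2, Delta_rat]
      have : (⇑(CuspForm.ofMulDiscriminant h2).toModularFormₗ : ℍ → ℂ) = ⇑CuspForm.discriminant * ⇑h2 := by
        ext z; simp
      rw [this, ModularForm.qExpansion_mul_coe one_pos one_mem_strictPeriods_SL, CuspForm.coe_discriminant]
    by_cases hodd : Odd (m : ℤ)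
    · refine ⟨0, ?_⟩
      rw [levelOne_odd_weight_eq_zero hodd h]
      simp [qExpansion_zero]
    have heven : Even m := by
      rw [← Nat.not_odd_iff_even]; exact_mod_cast hodd
    by_cases hm0 : m = 0
    · subst hm0
      obtain ⟨c, hc⟩ := ModularFormClass.levelOne_weight_zero_const (F := ModularForm 𝒮ℒ 0) h
      refine ⟨ModularForm.mcast (by simp) (ModularForm.const (Γ := 𝒮ℒ) (σ c)), ?_⟩
      have key : ∀ c : ℂ, qExpansion 1 (Function.const ℍ c) = PowerSeries.C c := by
        intro c
        have := ModularForm.qExpansion_smul (Γ := 𝒮ℒ) one_pos one_mem_strictPeriods_SL c (1 : ModularForm 𝒮ℒ 0)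
        rw [ModularForm.one_coe_eq_one, UpperHalfPlane.qExpansion_one] at this
        rw [show Function.const ℍ c = c • (1 : ℍ → ℂ) by ext; simp, this]
        rw [PowerSeries.smul_eq_C_mul, mul_one]
      have e : ⇑h = Function.const ℍ c := hc
      rw [e]
      rw [coe_mcast, ModularForm.coe_const, key, key]
      simp
    by_cases hm2 : m = 2
    · subst hm2
      refine ⟨0, ?_⟩
      have := rank_zero_iff_forall_zero.mp levelOne_weight_two_rank_zero h
      rw [this]
      simp [qExpansion_zero]
    have hm3 : 3 ≤ m := by
      rcases heven with ⟨r, hr⟩; omega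
    set a := (qExpansion 1 h).coeff 0 with ha
    obtain ⟨h2, hh2⟩ := cuspcase (h - a • E hm3)
      ((isCuspForm_iff_coeffZero_eq_zero _).mp (sub_smul_isCuspForm h (E hm3) (E_qExpansion_coeff_zero hm3 heven)))
    refine ⟨h2 + (σ a) • E hm3, ?_⟩
    rw [FunLike.coe_add, ModularForm.qExpansion_add one_pos one_mem_strictPeriods_SL, hh2,
      FunLike.coe_sub, ModularForm.qExpansion_sub one_pos one_mem_strictPeriods_SL, map_sub,
      FunLike.coe_smul, ModularForm.qExpansion_smul one_pos one_mem_strictPeriods_SL,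
      FunLike.coe_smul, ModularForm.qExpansion_smul one_pos one_mem_strictPeriods_SL,
      PowerSeries.smul_eq_C_mul, PowerSeries.smul_eq_C_mul, map_mul, PowerSeries.map_C, E_rat hm3 heven]
    simp

lemma levelOne_conj (σ : ℂ ≃+* ℂ) {k : ℤ} (h : ModularForm 𝒮ℒ k) :
    ∃ h' : ModularForm 𝒮ℒ k, qExpansion 1 h' = PowerSeries.map (σ : ℂ →+* ℂ) (qExpansion 1 h) :=
  levelOne_conj_nat σ (k.toNat + 1) k (by omega) h

end Part2

section Part3

lemma gamma0_slash {N : ℕ} {k : ℤ} (f : CuspForm (Gamma0 N) k) {γ : SL(2, ℤ)} (h : γ ∈ Gamma0 N) :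
    ⇑f ∣[k] γ = ⇑f := by
  have := SlashInvariantForm.slash_action_eqn f (γ : GL (Fin 2) ℝ) ⟨γ, h, rfl⟩
  rwa [ModularForm.SL_slash]

lemma exists_expansion (N : ℕ) [NeZero N] {k : ℤ} (f : CuspForm (Gamma0 N) k) (g : SL(2, ℤ)) :
    ∃ p : PowerSeries ℂ, HasExpansion N (⇑f ∣[k] g) (fun n => PowerSeries.coeff n p) := by
  have hN : (0:ℝ) < N := by exact_mod_cast Nat.pos_of_neZero N
  have hT : (⇑f ∣[k] g) ∣[k] (ModularGroup.T ^ (N : ℤ)) = ⇑f ∣[k] g := by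
    have h1 : g * (ModularGroup.T ^ (N : ℤ)) * g⁻¹ ∈ Gamma0 N := by
      have h2 := (Gamma_normal N).conj_mem _ (ModularGroup_T_pow_mem_Gamma N N dvd_rfl) g
      rw [Gamma_mem] at h2
      rw [Gamma0_mem]
      exact h2.2.2.1
    have h3 := gamma0_slash f h1
    conv_rhs => rw [← h3]
    rw [← SlashAction.slash_mul, ← SlashAction.slash_mul]
    simp [mul_assoc]
  have hper : Function.Periodic ((⇑f ∣[k] g) ∘ ofComplex) (N : ℝ) := by
    intro w
    by_cases hw : 0 < im w
    · have h0 : 0 < im (w + (N:ℝ)) := by simp [hw]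
      simp only [Function.comp_apply, ofComplex_apply_of_im_pos h0, ofComplex_apply_of_im_pos hw]
      have h1 := congr_fun hT ⟨w, hw⟩
      rw [ModularForm.SL_slash_apply, ModularGroup.denom_apply] at h1
      simp only [ModularGroup.coe_T_zpow, UpperHalfPlane.modular_T_zpow_smul] at h1
      rw [← h1]
      have e : ((N:ℤ):ℝ) +ᵥ (⟨w, hw⟩ : ℍ) = ⟨w + (N:ℝ), h0⟩ := by
        ext
        simp [add_comm]
      rw [e]
      simp
    · have : im (w + (N:ℝ)) ≤ 0 := by simpa using hw
      rw [Function.comp_apply, Function.comp_apply, ofComplex_apply_of_im_nonpos this, ofComplex_apply_of_im_nonpos (not_lt.mp hw)]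
  refine ⟨qExpansion (N:ℝ) (⇑f ∣[k] g), (hasExpansion_iff _ _ _).mpr fun τ => ?_⟩
  refine UpperHalfPlane.hasSum_qExpansion hN hper ?_ ?_ τ
  · rw [ModularForm.SL_slash]
    exact (CuspForm.translate f (g : GL (Fin 2) ℝ)).holo'
  · exact ModularFormClass.bdd_at_infty_slash f g

lemma hasExpansion_levelOne (N : ℕ) [NeZero N] {k : ℤ} (T : ModularForm 𝒮ℒ k) :
    HasExpansion N T (fun n => PowerSeries.coeff n (pexp N (qExpansion 1 T))) := by
  have h1 : HasExpansion 1 T (fun n => PowerSeries.coeff n (qExpansion 1 T)) := by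
    rw [hasExpansion_iff]
    intro τ
    have := ModularForm.hasSum_qExpansion T one_pos one_mem_strictPeriods_SL τ
    simpa using this
  have := hasExpansion_dilate 1 N N (Nat.pos_of_neZero N) h1 (G := T) 1 id 1 (by simp) (by
    intro τ
    rw [← qpow]
    simp only [Function.Periodic.qParam, id, one_mul]
    congr 1
    have : (N:ℂ) ≠ 0 := by exact_mod_cast NeZero.ne N
    field_simp
    simp)
  refine cast ?_ this
  congr 1
  ext n
  simp [pexp]

/-- functions invariant under everything, with an expansion, are level one forms -/
lemma levelOne_of_expansion (N : ℕ) [NeZero N] {k : ℤ} {F : ℍ → ℂ} {c : ℕ → ℂ} (h : HasExpansion N F c)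
    (hF : ∀ γ : SL(2, ℤ), F ∣[k] γ = F) : ∃ T : ModularForm 𝒮ℒ k, ⇑T = F := by
  refine ⟨{ toFun := F, slash_action_eq' := ?_, holo' := hasExpansion_mdiff N h, bdd_at_cusps' := ?_ }, rfl⟩
  · rintro _ ⟨γ, rfl⟩
    exact hF γ
  · intro c hc
    rw [Subgroup.IsArithmetic.isCusp_iff_isCusp_SL2Z] at hc
    rw [OnePoint.isBoundedAt_iff_forall_SL2Z hc]
    intro γ _
    rw [hF γ]
    exact hasExpansion_bdd N h

lemma pexp_map (N : ℕ) (p : PowerSeries ℂ) (σ : ℂ →+* ℂ) :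
    PowerSeries.map σ (pexp N p) = pexp N (PowerSeries.map σ p) := by
  ext n
  simp [pexp, apply_ite σ]

end Part3

section Part4

/-- lift of a bottom row -/
lemma exists_twist (N : ℕ) [NeZero N] (μ : ℤ) (hμ : IsCoprime μ (N:ℤ)) (g : SL(2, ℤ)) :
    ∃ g' : SL(2, ℤ), (N:ℤ) ∣ g' 1 0 - μ * g 1 0 ∧ (N:ℤ) ∣ g' 1 1 - g 1 1 := by
  have hN : (0:ℤ) < N := by exact_mod_cast Nat.pos_of_neZero N
  have hcop : IsCoprime (g 1 0) (g 1 1) := by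
    refine ⟨-g 0 1, g 0 0, ?_⟩
    have := g.det_coe
    rw [Matrix.det_fin_two] at this
    linarith
  obtain ⟨C2, hC2, hC2'⟩ : ∃ C2 : ℕ, 0 < C2 ∧ (N:ℤ) ∣ (C2:ℤ) - μ * g 1 0 := by
    refine ⟨((μ * g 1 0) % N).toNat + N, by have := Nat.pos_of_neZero N; omega, ?_⟩
    have h1 := Int.emod_nonneg (μ * g 1 0) hN.ne'
    push_cast
    rw [Int.toNat_of_nonneg h1]
    have h2 := Int.mul_ediv_add_emod (μ * g 1 0) N
    exact ⟨1 - (μ * g 1 0) / N, by linarith⟩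
  have : NeZero C2 := ⟨hC2.ne'⟩
  set e := Nat.gcd C2 N with he
  have he1 : (e:ℤ) ∣ C2 := by exact_mod_cast Nat.gcd_dvd_left C2 N
  have he2 : (e:ℤ) ∣ N := by exact_mod_cast Nat.gcd_dvd_right C2 N
  have he3 : (e:ℤ) ∣ μ * g 1 0 := by
    have := dvd_sub he1 (he2.trans hC2')
    simpa using this
  have he4 : (e:ℤ) ∣ g 1 0 := ((hμ.of_isCoprime_of_dvd_right he2).symm).dvd_of_dvd_mul_left he3
  have hD : IsCoprime (g 1 1) (e:ℤ) := (hcop.of_isCoprime_of_dvd_left he4).symm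
  obtain ⟨u, hu⟩ := ZMod.unitsMap_surjective (Nat.gcd_dvd_left C2 N) (ZMod.unitOfIsCoprime _ hD)
  obtain ⟨x, hx⟩ := ZMod.intCast_surjective (u : ZMod C2)
  have hxc : IsCoprime x (C2:ℤ) := by
    have h5 := (ZMod.coe_int_isUnit_iff_isCoprime x C2).mp (hx ▸ u.isUnit)
    exact h5.symm
  have hxD : (e:ℤ) ∣ x - g 1 1 := by
    have h1 := congr_arg Units.val hu
    rw [ZMod.unitsMap_val, ZMod.coe_unitOfIsCoprime, ← hx, ZMod.cast_intCast (Nat.gcd_dvd_left C2 N)] at h1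
    rw [← ZMod.intCast_zmod_eq_zero_iff_dvd]
    push_cast
    rw [h1, sub_self]
  obtain ⟨m, hm⟩ := hxD
  have hb := Nat.gcd_eq_gcd_ab C2 N
  rw [← he] at hb
  have hc2 : IsCoprime (C2:ℤ) (x - C2 * (m * Nat.gcdA C2 N)) := by
    have := hxc.symm.add_mul_left_right (-(m * Nat.gcdA C2 N))
    rwa [mul_neg, ← sub_eq_add_neg] at this
  obtain ⟨g', h1, h2⟩ := IsCoprime.exists_SL2_row hc2 1
  refine ⟨g', h1 ▸ hC2', h2 ▸ ⟨Nat.gcdB C2 N * m, ?_⟩⟩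
  have : x = g 1 1 + e * m := by linarith
  rw [this, hb]
  ring

/-- the point `(a τ + b)/d` -/
def affH (e n : ℕ) (he : 0 < e) (hn : 0 < n) (b : ℤ) (τ : ℍ) : ℍ :=
  ⟨((e:ℂ) * τ + b) / n, by
    have h1 : (((e:ℂ) * τ + b) / n).im = (e:ℝ) * τ.im / n := by
      simp [Complex.div_natCast_im]
    rw [h1]
    have := τ.im_pos
    positivity⟩

open EisensteinSeries ModularForm

/-- `E₄(Nτ)` -/
def Th (N : ℕ) [NeZero N] (τ : ℍ) : ℂ := E₄ (affH N 1 (Nat.pos_of_neZero N) one_pos 0 τ)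

lemma levelOne_slash {k : ℤ} (T : ModularForm 𝒮ℒ k) (γ : SL(2, ℤ)) : ⇑T ∣[k] γ = ⇑T :=
  SlashInvariantForm.slash_action_eqn T (γ : GL (Fin 2) ℝ) ⟨γ, rfl⟩

lemma slash_apply_smul {k : ℤ} (T : ℍ → ℂ) (γ : SL(2, ℤ)) (τ : ℍ) :
    T (γ • τ) = denom γ τ ^ k * (T ∣[k] γ) τ := by
  rw [ModularForm.SL_slash_apply, mul_comm (T _), ← mul_assoc, ← zpow_add₀ (denom_ne_zero _ _)]
  simp

lemma levelOne_smul {k : ℤ} (T : ModularForm 𝒮ℒ k) (γ : SL(2, ℤ)) (τ : ℍ) :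
    T (γ • τ) = denom γ τ ^ k * T τ := by
  rw [slash_apply_smul (k := k) T γ τ, levelOne_slash]

lemma Th_slash (N : ℕ) [NeZero N] (g : SL(2, ℤ)) (e n : ℕ) (he : 0 < e) (hn : 0 < n) (hN : N = e * n)
    (c b d : ℤ) (hC : g 1 0 = e * c) (hD : g 1 1 = c * b + n * d) (τ : ℍ) :
    (Th N ∣[(4:ℤ)] g) τ = ((n:ℂ)^4)⁻¹ * E₄ (affH e n he hn b τ) := by
  have hdet := g.det_coe
  rw [Matrix.det_fin_two] at hdet
  let γ : SL(2, ℤ) := ⟨!![n * g 0 0, e * g 0 1 - g 0 0 * b; c, d], by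
    rw [Matrix.det_fin_two_of]
    rw [hC, hD] at hdet
    linarith⟩
  have hn0 : (n:ℂ) ≠ 0 := by exact_mod_cast hn.ne'
  have hC' : ((g 1 0 : ℤ) : ℂ) = e * c := by rw [hC]; push_cast; rfl
  have hD' : ((g 1 1 : ℤ) : ℂ) = c * b + n * d := by rw [hD]; push_cast; rfl
  have hN' : (N:ℂ) = e * n := by rw [hN]; push_cast; rfl
  have hden : denom γ (affH e n he hn b τ) = denom g τ / n := by
    rw [ModularGroup.denom_apply, ModularGroup.denom_apply, hC', hD']
    simp only [γ, affH, Matrix.of_apply, Matrix.cons_val', Matrix.cons_val_zero, Matrix.cons_val_one, Matrix.cons_val_fin_one]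
    field_simp
    ring
  have hg0 := denom_ne_zero g τ
  have hpt : γ • (affH e n he hn b τ) = affH N 1 (Nat.pos_of_neZero N) one_pos 0 (g • τ) := by
    ext
    have h1 := denom_ne_zero γ (affH e n he hn b τ)
    rw [hden] at h1
    rw [ModularGroup.denom_apply] at hden h1 hg0
    rw [ModularGroup.denom_apply] at hden
    rw [coe_specialLinearGroup_apply]
    have e2 : ((affH N 1 (Nat.pos_of_neZero N) one_pos 0 (g • τ) : ℍ) : ℂ) = N * ((g • τ : ℍ) : ℂ) := by
      simp [affH]
    rw [e2, coe_specialLinearGroup_apply]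
    simp only [algebraMap_int_eq, eq_intCast, Complex.ofReal_intCast]
    rw [hden, hN']
    have e3 : ((affH e n he hn b τ : ℍ) : ℂ) = ((e:ℂ) * τ + b) / n := rfl
    rw [e3]
    simp only [γ, Matrix.of_apply, Matrix.cons_val', Matrix.cons_val_zero, Matrix.cons_val_one, Matrix.cons_val_fin_one]
    push_cast
    field_simp
    ring
  rw [ModularForm.SL_slash_apply, Th, ← hpt, levelOne_smul, hden, div_zpow]
  simp only [zpow_neg]
  field_simp

/-- coefficients of `Th N ∣ g` -/
def thc (e n : ℕ) (b : ℤ) : PowerSeries ℂ := PowerSeries.mk fun m =>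
  if e ^ 2 ∣ m then ((n:ℂ)^4)⁻¹ * PowerSeries.coeff (m / e ^ 2) (qExpansion 1 E₄) *
    Complex.exp (2 * Real.pi * Complex.I * b / n) ^ (m / e ^ 2) else 0

lemma Th_expansion (N : ℕ) [NeZero N] (g : SL(2, ℤ)) (e n : ℕ) (he : 0 < e) (hn : 0 < n) (hN : N = e * n)
    (c b d : ℤ) (hC : g 1 0 = e * c) (hD : g 1 1 = c * b + n * d) :
    HasExpansion N (Th N ∣[(4:ℤ)] g) (fun m => PowerSeries.coeff m (thc e n b)) := by
  have h1 : HasExpansion 1 E₄ (fun n => PowerSeries.coeff n (qExpansion 1 E₄)) := by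
    rw [hasExpansion_iff]
    intro τ
    have := ModularForm.hasSum_qExpansion E₄ one_pos one_mem_strictPeriods_SL τ
    simpa using this
  have := hasExpansion_dilate 1 N (e^2) (pow_pos he 2) h1 ((n:ℂ)^4)⁻¹ (affH e n he hn b) 
    (Complex.exp (2 * Real.pi * Complex.I * b / n))
    (Th_slash N g e n he hn hN c b d hC hD) (by
    intro τ
    rw [← qpow, ← Complex.exp_add]
    simp only [Function.Periodic.qParam, affH]
    congr 1
    have hN' : (N:ℂ) = e * n := by rw [hN]; push_cast; rfl
    have : (n:ℂ) ≠ 0 := by exact_mod_cast hn.ne'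
    have : (e:ℂ) ≠ 0 := by exact_mod_cast he.ne'
    rw [hN']
    push_cast
    field_simp
    ring)
  refine cast ?_ this
  congr 1
  ext n
  simp [thc]

lemma row_data (N : ℕ) [NeZero N] (g : SL(2, ℤ)) : ∃ (e n : ℕ) (_ : 0 < e) (_ : 0 < n) (_ : N = e * n)
    (c b d : ℤ), g 1 0 = e * c ∧ g 1 1 = c * b + n * d ∧ IsCoprime c (n:ℤ) := by
  have hN := Nat.pos_of_neZero N
  have he : 0 < Int.gcd (g 1 0) N := Int.gcd_pos_of_ne_zero_right _ (by exact_mod_cast hN.ne')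
  obtain ⟨n, hn⟩ : Int.gcd (g 1 0) N ∣ N := by exact_mod_cast Int.gcd_dvd_right (g 1 0) N
  obtain ⟨c, hc⟩ := Int.gcd_dvd_left (g 1 0) N
  set e := Int.gcd (g 1 0) N with hedef
  have hn0 : 0 < n := by
    rcases Nat.eq_zero_or_pos n with h | h
    · subst h; omega
    · exact h
  have hcop : IsCoprime c (n:ℤ) := by
    have h1 := Int.gcd_eq_gcd_ab (g 1 0) N
    rw [← hedef] at h1
    refine ⟨Int.gcdA (g 1 0) N, Int.gcdB (g 1 0) N, ?_⟩
    have he' : (e:ℤ) ≠ 0 := by exact_mod_cast he.ne'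
    have hn' : (N:ℤ) = e * n := by exact_mod_cast hn
    apply mul_left_cancel₀ he'
    linear_combination -h1 - (Int.gcdA (g 1 0) N) * hc - (Int.gcdB (g 1 0) N) * hn'
  obtain ⟨x, y, hxy⟩ := id hcop
  exact ⟨e, n, he, hn0, hn, c, x * g 1 1, y * g 1 1, hc, by linear_combination - g 1 1 * hxy, hcop⟩

lemma exp_eq_of (n : ℕ) (hn : 0 < n) (b b' : ℤ)
    (h : Complex.exp (2 * Real.pi * Complex.I * b / n) = Complex.exp (2 * Real.pi * Complex.I * b' / n)) :
    (n:ℤ) ∣ b - b' := by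
  obtain ⟨m, hm⟩ := Complex.exp_eq_exp_iff_exists_int.mp h
  refine ⟨m, ?_⟩
  have : (n:ℂ) ≠ 0 := by exact_mod_cast hn.ne'
  have h2 : (2 * Real.pi * Complex.I : ℂ) ≠ 0 := Complex.two_pi_I_ne_zero
  have : (b:ℂ) - b' = n * m := by
    apply mul_left_cancel₀ h2
    field_simp at hm
    linear_combination (2 * Real.pi * Complex.I : ℂ) * hm
  exact_mod_cast this

lemma Th_inj (N : ℕ) [NeZero N] (g g' : SL(2, ℤ)) (h : Th N ∣[(4:ℤ)] g = Th N ∣[(4:ℤ)] g') :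
    (N:ℤ) ∣ g 1 0 * g' 1 1 - g' 1 0 * g 1 1 := by
  obtain ⟨e, n, he, hn, hN, c, b, d, hC, hD, -⟩ := row_data N g
  obtain ⟨e', n', he', hn', hN', c', b', d', hC', hD', -⟩ := row_data N g'
  have h1 := Th_expansion N g e n he hn hN c b d hC hD
  have h2 := Th_expansion N g' e' n' he' hn' hN' c' b' d' hC' hD'
  rw [h] at h1
  have h3 := hasExpansion_unique N h1 h2
  have h0 := congr_fun h3 0
  have hE0 : PowerSeries.coeff 0 (qExpansion 1 E₄) = 1 := E_qExpansion_coeff_zero _ ⟨2, rfl⟩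
  simp only [thc, PowerSeries.coeff_mk, dvd_zero, if_true, Nat.zero_div, hE0, pow_zero, mul_one] at h0
  have hnn : n = n' := by
    have h4 : (n:ℂ)^4 = (n':ℂ)^4 := inv_injective h0
    have h5 : n^4 = n'^4 := by exact_mod_cast h4
    exact Nat.pow_left_injective (by norm_num : 4 ≠ 0) h5
  subst hnn
  have hee : e = e' := Nat.eq_of_mul_eq_mul_right hn (hN.symm.trans hN')
  subst hee
  have h6 := congr_fun h3 (e^2)
  have hn0 : (n:ℂ) ≠ 0 := by exact_mod_cast hn.ne'
  simp only [thc, PowerSeries.coeff_mk, dvd_refl, if_true, Nat.div_self (pow_pos he 2), E₄_qExpansion_coeff_one, pow_one] at h6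
  have h7 := mul_left_cancel₀ (mul_ne_zero (inv_ne_zero (pow_ne_zero 4 hn0)) (by norm_num)) h6
  obtain ⟨m, hm⟩ := exp_eq_of n hn b b' h7
  have hN' : (N:ℤ) = e * n := by exact_mod_cast hN
  rw [hN', hC, hD, hC', hD']
  exact ⟨-c * c' * m + c * d' - c' * d, by linear_combination (-e * c * c') * hm⟩

lemma Th_galois (N : ℕ) [NeZero N] (σ : ℂ ≃+* ℂ) (l : ℕ) (μ : ℤ) (hμ : (N:ℤ) ∣ μ * l - 1)
    (hσ : σ (zetaC N) = zetaC N ^ l) (g g' : SL(2, ℤ)) 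
    (hc : (N:ℤ) ∣ g' 1 0 - μ * g 1 0) (hd : (N:ℤ) ∣ g' 1 1 - g 1 1) :
    ∃ p : PowerSeries ℂ, HasExpansion N (Th N ∣[(4:ℤ)] g) (fun m => PowerSeries.coeff m p) ∧
      HasExpansion N (Th N ∣[(4:ℤ)] g') (fun m => PowerSeries.coeff m (PowerSeries.map (σ : ℂ →+* ℂ) p)) := by
  obtain ⟨e, n, he, hn, hN, c, b, d, hC, hD, -⟩ := row_data N g
  have hn0 : (n:ℂ) ≠ 0 := by exact_mod_cast hn.ne'
  have he0 : (e:ℂ) ≠ 0 := by exact_mod_cast he.ne'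
  refine ⟨_, Th_expansion N g e n he hn hN c b d hC hD, ?_⟩
  have key : PowerSeries.map (σ : ℂ →+* ℂ) (thc e n b) = thc e n (l * b) := by
    have hz : Complex.exp (2 * Real.pi * Complex.I * b / n) = zetaC N ^ (e * b) := by
      rw [zetaC, ← Complex.exp_int_mul, hN]
      congr 1
      push_cast
      field_simp
    have hz' : Complex.exp (2 * Real.pi * Complex.I * ((l * b : ℤ) : ℂ) / n) = (zetaC N ^ l) ^ (e * b) := by
      rw [zetaC, ← Complex.exp_nat_mul, ← Complex.exp_int_mul, hN]
      congr 1
      push_cast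
      field_simp
    ext m
    rw [PowerSeries.coeff_map]
    simp only [thc, PowerSeries.coeff_mk, hz, hz']
    rw [apply_ite (σ : ℂ →+* ℂ)]
    have hE := congr_arg (PowerSeries.coeff (m / e^2)) (E_rat (by norm_num : 3 ≤ 4) (by decide) σ)
    rw [PowerSeries.coeff_map] at hE
    simp only [map_mul, map_zero, hE, map_inv₀, map_pow, map_natCast, RingHom.coe_coe, map_zpow₀, hσ]
  rw [key]
  have hN' : (N:ℤ) = e * n := by exact_mod_cast hN
  rw [hN'] at hc hd hμ
  obtain ⟨x, hx⟩ := hc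
  obtain ⟨y, hy⟩ := hd
  obtain ⟨z, hz⟩ := hμ
  refine Th_expansion N g' e n he hn hN (μ * c + n * x) (l * b) (d + e * y - x * l * b - z * e * c * b) ?_ ?_
  · rw [hC] at hx
    linear_combination hx
  · rw [hD] at hy
    linear_combination hy - c * b * hz

end Part4

section Part5

section Lf
variable {R S X : Type*} [CommRing R] [CommRing S] [Fintype X] [DecidableEq X]

/-- the linear functional `X^i ↦ T i` applied to `∏_{z ≠ y} (X - a z)` -/
def Lf (y : X) (a : X → R) (T : ℕ → R) : R :=
  ∑ t ∈ (Finset.univ.erase y).powerset, T t.card * ∏ z ∈ (Finset.univ.erase y) \ t, (- a z)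

lemma Lf_map (φ : R →+* S) (y : X) (a : X → R) (T : ℕ → R) :
    φ (Lf y a T) = Lf y (fun z => φ (a z)) (fun i => φ (T i)) := by
  simp [Lf, map_sum, map_mul, map_prod]

lemma Lf_sum (y : X) (a U b : X → R) :
    Lf y a (fun i => ∑ x, U x * b x ^ i) = ∑ x, U x * ∏ z ∈ Finset.univ.erase y, (b x - a z) := by
  simp only [Lf, sub_eq_add_neg, Finset.prod_add, Finset.sum_mul, Finset.mul_sum, Finset.prod_const]
  rw [Finset.sum_comm]
  refine Finset.sum_congr rfl fun x _ => Finset.sum_congr rfl fun t _ => ?_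
  ring

lemma Lf_eval (y : X) (Q : X → R) (pp ρ : X → X) (hpp : Function.Injective pp) (hρ : Function.Surjective ρ)
    (U : X → R) (x0 : X) (h : pp x0 = ρ y) :
    Lf y (fun z => Q (ρ z)) (fun i => ∑ x, U x * Q (pp x) ^ i) =
      U x0 * ∏ z ∈ Finset.univ.erase y, (Q (ρ y) - Q (ρ z)) := by
  rw [Lf_sum, Finset.sum_eq_single x0]
  · rw [h]
  · intro x _ hx
    obtain ⟨z, hz⟩ := hρ (pp x)
    have hzy : z ≠ y := by
      rintro rfl
      exact hx (hpp (hz.symm.trans h.symm))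
    rw [Finset.prod_eq_zero (i := z) (by simp [hzy]) (by rw [hz, sub_self]), mul_zero]
  · simp

lemma Lf_scale (y : X) (a : X → ℂ) (T : ℕ → ℂ) (j : ℂ) (hj : j ≠ 0) (k : ℤ) :
    Lf y (fun z => j ^ (4:ℤ) * a z) (fun i => j ^ (k + 4 * i) * T i) =
      j ^ (k + 4 * ((Finset.univ.erase y).card : ℤ)) * Lf y a T := by
  simp only [Lf, Finset.mul_sum]
  refine Finset.sum_congr rfl fun t ht => ?_
  rw [Finset.mem_powerset] at ht
  have h1 : ∏ z ∈ Finset.univ.erase y \ t, (-(j ^ (4:ℤ) * a z)) =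
      j ^ (4 * ((Finset.univ.erase y \ t).card : ℤ)) * ∏ z ∈ Finset.univ.erase y \ t, (- a z) := by
    simp only [← mul_neg]
    rw [Finset.prod_mul_distrib, Finset.prod_const, zpow_mul, zpow_natCast]
  rw [h1]
  have h2 : ((Finset.univ.erase y).card : ℤ) = t.card + (Finset.univ.erase y \ t).card := by
    rw [← Finset.card_sdiff_add_card_eq_card ht]
    push_cast
    ring
  have h3 : j ^ (k + 4 * ((t.card : ℤ) + (Finset.univ.erase y \ t).card)) =
      j ^ (k + 4 * (t.card : ℤ)) * j ^ (4 * ((Finset.univ.erase y \ t).card : ℤ)) := by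
    rw [← zpow_add₀ hj]
    congr 1
    ring
  rw [h2, h3]
  ring

end Lf

section slashX
variable {N : ℕ}

/-- `F|h⁻¹` for a coset `hΓ₀(N)` -/
def slashX (F : ℍ → ℂ) (k : ℤ) (x : SL(2, ℤ) ⧸ Gamma0 N) : ℍ → ℂ := F ∣[k] (x.out)⁻¹

/-- coset of `g⁻¹` -/
def qX (N : ℕ) (g : SL(2, ℤ)) : SL(2, ℤ) ⧸ Gamma0 N := QuotientGroup.mk g⁻¹

lemma slashX_q {F : ℍ → ℂ} {k : ℤ} (hF : ∀ γ ∈ Gamma0 N, F ∣[k] γ = F) (g : SL(2, ℤ)) :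
    slashX F k (qX N g) = F ∣[k] g := by
  obtain ⟨h, hh⟩ := QuotientGroup.mk_out_eq_mul (Gamma0 N) g⁻¹
  rw [slashX, qX, hh, mul_inv_rev, inv_inv, SlashAction.slash_mul, hF _ (inv_mem h.2)]

lemma slashX_slash {F : ℍ → ℂ} {k : ℤ} (hF : ∀ γ ∈ Gamma0 N, F ∣[k] γ = F) (x) (g : SL(2, ℤ)) :
    (slashX F k x) ∣[k] g = slashX F k (g⁻¹ • x : SL(2, ℤ) ⧸ Gamma0 N) := by
  rw [slashX, ← SlashAction.slash_mul, ← slashX_q hF]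
  congr 1
  rw [qX, mul_inv_rev, inv_inv]
  conv_rhs => rw [← QuotientGroup.out_eq' x]
  rfl

lemma qX_eq (g g' : SL(2, ℤ)) : qX N g = qX N g' ↔ (N:ℤ) ∣ g 1 0 * g' 1 1 - g' 1 0 * g 1 1 := by
  rw [qX, qX, QuotientGroup.eq, inv_inv, Gamma0_mem, ZMod.intCast_zmod_eq_zero_iff_dvd]
  have : (g * g'⁻¹) 1 0 = g 1 0 * g' 1 1 - g' 1 0 * g 1 1 := by
    rw [Matrix.SpecialLinearGroup.coe_mul, Matrix.SpecialLinearGroup.coe_inv, Matrix.adjugate_fin_two]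
    simp [Matrix.mul_apply, Fin.sum_univ_two]
    ring
  rw [this]

lemma Th_inv [NeZero N] : ∀ γ ∈ Gamma0 N, Th N ∣[(4:ℤ)] γ = Th N := by
  intro γ hγ
  rw [Gamma0_mem, ZMod.intCast_zmod_eq_zero_iff_dvd] at hγ
  obtain ⟨c, hc⟩ := hγ
  have hN := Nat.pos_of_neZero N
  have h1 := Th_expansion N γ N 1 hN one_pos (by simp) c 0 (γ 1 1) hc (by simp)
  have h2 := Th_expansion N 1 N 1 hN one_pos (by simp) 0 0 1 (by simp) (by simp)
  rw [SlashAction.slash_one] at h2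
  exact hasExpansion_fun_unique N h1 h2

lemma mul_pow_slash (F G : ℍ → ℂ) (k : ℤ) (i : ℕ) (g : SL(2, ℤ)) :
    (F * G ^ i) ∣[k + 4 * i] g = (F ∣[k] g) * (G ∣[(4:ℤ)] g) ^ i := by
  ext τ
  simp only [ModularForm.SL_slash_apply, Pi.mul_apply, Pi.pow_apply, mul_pow]
  have hj : denom g τ ≠ 0 := denom_ne_zero g τ
  rw [neg_add, zpow_add₀ hj, ← zpow_natCast (denom _ _ ^ (-4:ℤ)), ← zpow_mul, neg_mul]
  ring

end slashX

variable {N : ℕ} [NeZero N]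

/-- evaluation -/
def evR (τ : ℍ) : expRing N →+* ℂ :=
  (Pi.evalRingHom (fun _ : ℍ => ℂ) τ).comp ((RingHom.fst (ℍ → ℂ) (PowerSeries ℂ)).comp (expRing N).subtype)

def psR : expRing N →+* PowerSeries ℂ := (RingHom.snd (ℍ → ℂ) (PowerSeries ℂ)).comp (expRing N).subtype

lemma ev_of_ps {r r' : expRing N} (h : psR r = psR r') (τ : ℍ) : evR τ r = evR τ r' := by
  have h1 := mem_expRing.mp r.2
  have h2 := mem_expRing.mp r'.2
  have h3 : r.1.2 = r'.1.2 := h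
  rw [h3] at h1
  exact congr_fun (hasExpansion_fun_unique N h1 h2) τ

lemma ps_of_ev {r r' : expRing N} (h : ∀ τ, evR τ r = evR τ r') : psR r = psR r' := by
  have h1 := mem_expRing.mp r.2
  have h2 := mem_expRing.mp r'.2
  have h3 : r.1.1 = r'.1.1 := funext h
  rw [h3] at h1
  have := hasExpansion_unique N h1 h2
  ext n
  exact congr_fun this n

lemma hasExpansion_up (N : ℕ) [NeZero N] {F : ℍ → ℂ} {c : ℕ → ℂ} (h1 : HasExpansion 1 F c) :
    HasExpansion N F (fun n => if N ∣ n then c (n / N) else 0) := by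
  have := hasExpansion_dilate 1 N N (Nat.pos_of_neZero N) h1 (G := F) 1 id 1 (by simp) (by
    intro τ
    rw [← qpow]
    simp only [Function.Periodic.qParam, id, one_mul]
    congr 1
    have : (N:ℂ) ≠ 0 := by exact_mod_cast NeZero.ne N
    field_simp
    simp)
  simpa using this

lemma galois_slash {k : ℤ} (f fσ : CuspForm (Gamma0 N) k) (σ : ℂ ≃+* ℂ) (cf cσ : ℕ → ℂ)
    (hcf : HasExpansion 1 f cf) (hcσ : HasExpansion 1 fσ cσ) (hconj : ∀ n, 1 ≤ n → cσ n = σ (cf n))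
    (l : ℕ) (μ : ℤ) (hl : IsCoprime μ (N:ℤ)) (hμ : (N:ℤ) ∣ μ * l - 1)
    (hσ : σ (zetaC N) = zetaC N ^ l) (g0 g : SL(2, ℤ))
    (hc : (N:ℤ) ∣ g 1 0 - μ * g0 1 0) (hd : (N:ℤ) ∣ g 1 1 - g0 1 1)
    (c : ℕ → ℂ) (hexp : HasExpansion N (⇑f ∣[k] g0) c) :
    HasExpansion N (⇑fσ ∣[k] g) (fun n => σ (c n)) := by
  classical
  let X := SL(2, ℤ) ⧸ Gamma0 N
  have : Finite X := Subgroup.finite_quotient_of_finiteIndex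
  let _ : Fintype X := Fintype.ofFinite X
  have hf : ∀ γ ∈ Gamma0 N, ⇑f ∣[k] γ = ⇑f := fun γ h => gamma0_slash f h
  have hfσ : ∀ γ ∈ Gamma0 N, ⇑fσ ∣[k] γ = ⇑fσ := fun γ h => gamma0_slash fσ h
  -- expansions
  have hP : ∀ x : X, ∃ p : PowerSeries ℂ, HasExpansion N (slashX (⇑f) k x) (fun n => PowerSeries.coeff n p) :=
    fun x => exists_expansion N f _
  choose P hP using hP
  have htw : ∀ x : X, ∃ g' : SL(2, ℤ), (N:ℤ) ∣ g' 1 0 - μ * (x.out)⁻¹ 1 0 ∧ (N:ℤ) ∣ g' 1 1 - (x.out)⁻¹ 1 1 :=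
    fun x => exists_twist N μ hl _
  choose tw htw1 htw2 using htw
  have hQ : ∀ x : X, ∃ p : PowerSeries ℂ, HasExpansion N (slashX (Th N) 4 x) (fun n => PowerSeries.coeff n p) ∧
      HasExpansion N (Th N ∣[(4:ℤ)] (tw x)) (fun m => PowerSeries.coeff m (PowerSeries.map (σ : ℂ →+* ℂ) p)) :=
    fun x => Th_galois N σ l μ hμ hσ _ _ (htw1 x) (htw2 x)
  choose Q hQ hQtw using hQ
  let pp : X → X := fun x => qX N (tw x)
  have psuniq : ∀ {F : ℍ → ℂ} {p p' : PowerSeries ℂ}, HasExpansion N F (fun n => PowerSeries.coeff n p) →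
      HasExpansion N F (fun n => PowerSeries.coeff n p') → p = p' := by
    intro F p p' h h'
    ext n
    exact congr_fun (hasExpansion_unique N h h') n
  have hQpp : ∀ x, PowerSeries.map (σ : ℂ →+* ℂ) (Q x) = Q (pp x) := by
    intro x
    refine psuniq (hQtw x) ?_
    rw [← slashX_q Th_inv]
    exact hQ _
  have hQinj : Function.Injective Q := by
    intro x x' h
    have h1 := hQ x
    rw [h] at h1
    have h2 := hasExpansion_fun_unique N h1 (hQ x')
    have h3 := Th_inj N _ _ h2
    rw [← qX_eq] at h3
    simpa [qX] using h3
  have hmapinj : Function.Injective (PowerSeries.map (σ : ℂ →+* ℂ)) := by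
    intro p p' h
    ext n
    have := congr_arg (PowerSeries.coeff n) h
    simpa using this
  have hppinj : Function.Injective pp := by
    intro x x' h
    apply hQinj
    apply hmapinj
    rw [hQpp, hQpp, h]
  let U : X → PowerSeries ℂ := fun x => PowerSeries.map (σ : ℂ →+* ℂ) (P x)
  -- traces
  have hT : ∀ i : ℕ, ∃ T' : ModularForm 𝒮ℒ (k + 4 * i),
      HasExpansion N T' (fun n => PowerSeries.coeff n (∑ x, U x * Q (pp x) ^ i)) := by
    intro i
    have h1 : (∑ x : X, (slashX (⇑f) k x) * (slashX (Th N) 4 x) ^ i, ∑ x : X, P x * Q x ^ i) ∈ expRing N := by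
      have : ∀ x ∈ (Finset.univ : Finset X), ((slashX (⇑f) k x, P x) : (ℍ → ℂ) × PowerSeries ℂ) * ((slashX (Th N) 4 x, Q x) : (ℍ → ℂ) × PowerSeries ℂ) ^ i ∈ expRing N :=
        fun x _ => mul_mem (hP x) (pow_mem (hQ x) i)
      have := sum_mem this
      refine cast (congr_arg (· ∈ expRing N) ?_) this
      ext1
      · simp [Prod.fst_sum]
      · simp [Prod.snd_sum]
    obtain ⟨T, hT⟩ := levelOne_of_expansion N (k := k + 4 * i) (mem_expRing.mp h1) (by
      intro γ
      rw [SlashAction.sum_slash]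
      simp only [mul_pow_slash, slashX_slash hf, slashX_slash Th_inv]
      exact Equiv.sum_comp (MulAction.toPerm γ⁻¹ : Equiv.Perm X) (fun x => slashX (⇑f) k x * slashX (Th N) 4 x ^ i))
    obtain ⟨T', hT'⟩ := levelOne_conj σ T
    refine ⟨T', ?_⟩
    have h2 := hasExpansion_levelOne N T'
    have h3 := hasExpansion_levelOne N T
    rw [hT'] at h2
    rw [hT] at h3
    rw [← pexp_map] at h2
    have h4 := psuniq h3 (mem_expRing.mp h1)
    rw [hT] at h2
    rw [h4] at h2
    simpa only [map_sum, map_mul, map_pow, hQpp] using h2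
  choose T' hT' using hT
  let Θ : X → expRing N := fun x => ⟨(slashX (Th N) 4 x, Q x), hQ x⟩
  let TT : ℕ → expRing N := fun i => ⟨(⇑(T' i), ∑ x, U x * Q (pp x) ^ i), hT' i⟩
  -- base point
  let y0 : X := qX N 1
  have hpsΘ : ∀ x, psR (Θ x) = Q x := fun _ => rfl
  have hpsT : ∀ i, psR (TT i) = ∑ x, U x * Q (pp x) ^ i := fun _ => rfl
  have key : ∀ (a b : SL(2, ℤ)), (N:ℤ) ∣ b 1 0 - μ * a 1 0 → (N:ℤ) ∣ b 1 1 - a 1 1 → pp (qX N a) = qX N b := by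
    intro a b h1 h2
    obtain ⟨p, hp1, hp2⟩ := Th_galois N σ l μ hμ hσ a b h1 h2
    rw [← slashX_q Th_inv] at hp1 hp2
    have e1 := psuniq hp1 (hQ _)
    have e2 := psuniq hp2 (hQ _)
    apply hQinj
    rw [← hQpp, ← e1, e2]
  have hpp0 : pp y0 = y0 := key 1 1 (by simp) (by simp)
  have hU0 : HasExpansion N fσ (fun n => PowerSeries.coeff n (U y0)) := by
    have e0 := hP y0
    rw [slashX_q hf, SlashAction.slash_one] at e0
    have e1 := hasExpansion_unique N e0 (hasExpansion_up N hcf)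
    have z1 : cf 0 = 0 := hasExpansion_zero_coeff 1 hcf (by
      have := CuspFormClass.zero_at_infty_slash f 1
      rwa [SlashAction.slash_one] at this)
    have z2 : cσ 0 = 0 := hasExpansion_zero_coeff 1 hcσ (by
      have := CuspFormClass.zero_at_infty_slash fσ 1
      rwa [SlashAction.slash_one] at this)
    have e3 := hasExpansion_up N hcσ
    refine cast ?_ e3
    congr 1
    ext n
    have e4 := congr_fun e1 n
    simp only [U, PowerSeries.coeff_map, e4, apply_ite (σ : ℂ →+* ℂ), map_zero]
    congr 1
    rcases Nat.eq_zero_or_pos (n / N) with h | h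
    · rw [h, z1, z2]; simp
    · exact hconj _ h
  let Fσ : expRing N := ⟨(⇑fσ, U y0), hU0⟩
  have stepB : psR (Fσ * ∏ z ∈ Finset.univ.erase y0, (Θ y0 - Θ z)) = psR (Lf y0 Θ TT) := by
    rw [Lf_map, map_mul, map_prod]
    simp only [map_sub, hpsΘ, hpsT]
    exact (Lf_eval y0 Q pp id hppinj Function.surjective_id U y0 hpp0).symm
  obtain ⟨V, hV⟩ := exists_expansion N fσ g
  let G : expRing N := ⟨(⇑fσ ∣[k] g, V), hV⟩
  let ρ : X → X := fun x => g⁻¹ • x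
  have stepC : ∀ τ, evR τ (G * ∏ z ∈ Finset.univ.erase y0, (Θ (ρ y0) - Θ (ρ z))) = evR τ (Lf y0 (fun z => Θ (ρ z)) TT) := by
    intro τ
    have h1 := ev_of_ps stepB (g • τ)
    have hj : denom g τ ≠ 0 := denom_ne_zero g τ
    have e1 : ∀ x, evR (g • τ) (Θ x) = denom g τ ^ (4:ℤ) * evR τ (Θ (ρ x)) := by
      intro x
      change slashX (Th N) 4 x (g • τ) = _ * slashX (Th N) 4 (ρ x) τ
      rw [slash_apply_smul (k := 4) (slashX (Th N) 4 x) g τ, slashX_slash Th_inv]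
    have e2 : ∀ i, evR (g • τ) (TT i) = denom g τ ^ (k + 4 * i) * evR τ (TT i) := fun i =>
      levelOne_smul (T' i) g τ
    have e3 : evR (g • τ) Fσ = denom g τ ^ k * evR τ G := slash_apply_smul (k := k) (⇑fσ) g τ
    rw [Lf_map, map_mul, map_prod] at h1
    simp only [map_sub, e1, e2, e3] at h1
    rw [Lf_scale _ _ _ _ hj] at h1
    simp only [← mul_sub] at h1
    rw [Finset.prod_mul_distrib, Finset.prod_const] at h1
    rw [Lf_map, map_mul, map_prod]
    simp only [map_sub]
    refine mul_left_cancel₀ (zpow_ne_zero (k + 4 * ((Finset.univ.erase y0).card : ℤ)) hj) ?_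
    rw [← h1, zpow_add₀ hj, zpow_mul (denom _ _) 4, zpow_natCast]
    ring
  have stepD := ps_of_ev stepC
  rw [Lf_map, map_mul, map_prod] at stepD
  simp only [map_sub, hpsΘ, hpsT] at stepD
  have hρ0 : ρ y0 = qX N g := by
    simp only [ρ, y0, qX]
    rw [inv_one]
    change QuotientGroup.mk (g⁻¹ * 1) = _
    rw [mul_one]
  rw [Lf_eval y0 Q pp ρ hppinj (MulAction.surjective g⁻¹) U (qX N g0) ((key g0 g hc hd).trans hρ0.symm)] at stepD
  have hne : ∏ z ∈ Finset.univ.erase y0, (Q (ρ y0) - Q (ρ z)) ≠ 0 := by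
    rw [Finset.prod_ne_zero_iff]
    intro z hz h0
    have := MulAction.injective g⁻¹ (hQinj (sub_eq_zero.mp h0))
    simp [this] at hz
  have hVU := mul_right_cancel₀ hne stepD
  have hVU' : V = U (qX N g0) := hVU
  have hPc := hP (qX N g0)
  rw [slashX_q hf] at hPc
  have hPc' := hasExpansion_unique N hPc hexp
  rw [hVU'] at hV
  rw [← hPc']
  simpa [U] using hV

end Part5

section Part6

open Polynomial in
lemma parity_transc {K : Type*} [Field K] {E : Type*} [Field E] [Algebra K E] (x : E)
    (hx : Transcendental K x) : x ∉ IntermediateField.adjoin K {x ^ 2} := by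
  intro h
  rw [IntermediateField.mem_adjoin_simple_iff] at h
  obtain ⟨r, s, h⟩ := h
  have hx0 : x ≠ 0 := by
    rintro rfl
    exact hx (isAlgebraic_zero)
  have hs : aeval (x ^ 2) s ≠ 0 := by
    intro h0
    rw [h0, div_zero] at h
    exact hx0 h
  rw [eq_div_iff hs] at h
  have h1 : aeval x (X * expand K 2 s - expand K 2 r) = 0 := by
    simp [expand_aeval, h]
  have h2 := (transcendental_iff.mp hx) _ h1
  rw [sub_eq_zero] at h2
  have hs0 : s ≠ 0 := by
    rintro rfl
    simp at hs
  have h3 := congrArg natDegree h2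
  rw [natDegree_X_mul (by simpa [expand_eq_zero] using hs0), natDegree_expand, natDegree_expand] at h3
  omega

lemma alg_in_transc {K : Type*} [Field K] {E : Type*} [Field E] [Algebra K E] (x t : E)
    (ht : Transcendental K t) (hx : IsAlgebraic K x) (h : x ∈ IntermediateField.adjoin K {t}) :
    x ∈ Set.range (algebraMap K E) := by
  let e := RatFunc.algEquivOfTranscendental t ht
  let y : IntermediateField.adjoin K {t} := ⟨x, h⟩
  by_cases hc : ∃ c, e.symm y = RatFunc.C c
  · obtain ⟨c, hc⟩ := hc
    refine ⟨c, ?_⟩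
    have : y = algebraMap K _ c := by
      rw [← e.symm.injective.eq_iff, hc, e.symm.commutes]
      rfl
    have h2 := congrArg Subtype.val this
    exact h2.symm
  · exfalso
    apply RatFunc.transcendental_of_ne_C _ hc
    have : IsAlgebraic K y := by
      rw [← isAlgebraic_algebraMap_iff (A := E) (FaithfulSMul.algebraMap_injective _ _)]
      exact hx
    exact this.algHom e.symm.toAlgHom

lemma exists_max_subfield (L : Subfield ℂ) (x : ℂ) (hx : x ∉ L) :
    ∃ M : Subfield ℂ, L ≤ M ∧ x ∉ M ∧ ∀ M' : Subfield ℂ, M ≤ M' → x ∉ M' → M' ≤ M := by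
  obtain ⟨M, hLM, hM⟩ := zorn_le_nonempty₀ {M : Subfield ℂ | x ∉ M} (by
    intro c hc hch y hy
    refine ⟨sSup c, ?_, fun z hz => le_sSup hz⟩
    intro hmem
    rw [Subfield.mem_sSup_of_directedOn ⟨y, hy⟩ hch.directedOn] at hmem
    obtain ⟨s, hs, hxs⟩ := hmem
    exact hc hs hxs) L hx
  exact ⟨M, hLM, hM.prop, fun M' h h' => hM.le_of_ge h' h⟩

lemma exists_aut_move (L : Subfield ℂ) (x : ℂ) (hx : x ∉ L) :
    ∃ σ : ℂ ≃+* ℂ, (∀ y ∈ L, σ y = y) ∧ σ x ≠ x := by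
  obtain ⟨M, hLM, hxM, hmax⟩ := exists_max_subfield L x hx
  have key : ∀ t : ℂ, t ∉ M → x ∈ IntermediateField.adjoin M {t} := by
    intro t ht
    by_contra hcon
    apply ht
    refine hmax (IntermediateField.adjoin M {t}).toSubfield ?_ hcon ?_
    · intro y hy
      exact (IntermediateField.adjoin M {t}).algebraMap_mem ⟨y, hy⟩
    · exact IntermediateField.mem_adjoin_simple_self M t
  have tr_not : ∀ t : ℂ, Transcendental M t → t ∉ M := by
    intro t ht h
    exact ht (isAlgebraic_algebraMap (⟨t, h⟩ : M))
  have hxalg : IsAlgebraic M x := by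
    by_contra h
    have h' : Transcendental M x := h
    exact parity_transc x h' (key (x ^ 2) (tr_not _ (h'.pow (by norm_num))))
  haveI : Algebra.IsAlgebraic M ℂ := by
    constructor
    intro t
    by_contra h
    obtain ⟨y, hy⟩ := alg_in_transc x t h hxalg (key t (tr_not t h))
    exact hxM (hy ▸ y.2)
  haveI : IsGalois M ℂ := by
    haveI : IsAlgClosure M ℂ := ⟨inferInstance, inferInstance⟩
    haveI : Normal M ℂ := IsAlgClosure.normal M ℂ
    exact ⟨⟩
  by_contra hcon
  push Not at hcon
  have : x ∈ Set.range (algebraMap M ℂ) := by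
    rw [InfiniteGalois.mem_range_algebraMap_iff_fixed]
    intro φ
    apply hcon φ.toRingEquiv
    intro y hy
    exact φ.commutes ⟨y, hLM hy⟩
  obtain ⟨y, hy⟩ := this
  exact hxM (hy ▸ y.2)

lemma zetaC_prim (N : ℕ) [NeZero N] : IsPrimitiveRoot (zetaC N) N :=
  Complex.isPrimitiveRoot_exp N (NeZero.ne N)

lemma aut_zeta (N : ℕ) [NeZero N] (σ : ℂ ≃+* ℂ) :
    ∃ (l : ℕ) (μ : ℤ), σ (zetaC N) = zetaC N ^ l ∧ IsCoprime μ (N : ℤ) ∧ (N : ℤ) ∣ μ * l - 1 := by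
  have h := (zetaC_prim N).map_of_injective (f := σ) σ.injective
  obtain ⟨l, -, hl, he⟩ := ((zetaC_prim N).isPrimitiveRoot_iff).mp h
  have hl' : IsCoprime (l : ℤ) (N : ℤ) := Nat.isCoprime_iff_coprime.mpr hl
  obtain ⟨a, b, hab⟩ := hl'
  refine ⟨l, a, he.symm, ⟨l, b, by linarith⟩, ⟨-b, by linarith⟩⟩

lemma zetaC_pow_div (N N' d : ℕ) (hd : d * N' = N) [NeZero N] : zetaC N' = zetaC N ^ d := by
  have hN := NeZero.ne N
  have hd0 : d ≠ 0 := by rintro rfl; simp at hd; exact hN hd.symm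
  have hN' : N' ≠ 0 := by rintro rfl; simp at hd; exact hN hd.symm
  unfold zetaC
  rw [← Complex.exp_nat_mul]
  congr 1
  subst hd
  push_cast
  field_simp

/-- action on `ζ_{N'}` -/
lemma aut_zeta_div (N N' d : ℕ) (hd : d * N' = N) [NeZero N] (σ : ℂ ≃+* ℂ) (l : ℕ)
    (hσ : σ (zetaC N) = zetaC N ^ l) : σ (zetaC N') = zetaC N' ↔ (N' : ℤ) ∣ l - 1 := by
  have hN := NeZero.ne N
  have hN' : N' ≠ 0 := by rintro rfl; simp at hd; exact hN hd.symm
  haveI : NeZero N' := ⟨hN'⟩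
  have h1 : σ (zetaC N') = zetaC N' ^ l := by
    rw [zetaC_pow_div N N' d hd, map_pow, hσ, ← pow_mul, ← pow_mul, mul_comm]
  rw [h1]
  have hz : zetaC N' ≠ 0 := Complex.exp_ne_zero _
  have := (zetaC_prim N').zpow_eq_one_iff_dvd ((l:ℤ) - 1)
  rw [← this, zpow_sub₀ hz, zpow_natCast, zpow_one,
    div_eq_one_iff_eq hz]

end Part6

section Part7

lemma dvd24 (r : ℕ) (hr : r ≠ 0) (h : ∀ a : ℤ, IsCoprime a (r:ℤ) → (r:ℤ) ∣ a ^ 2 - 1) : r ∣ 24 := by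
  obtain ⟨e, m, hm, rfl⟩ := Nat.exists_eq_two_pow_mul_odd hr
  have h2m : IsCoprime (2:ℤ) (m:ℤ) := by
    have := (Nat.coprime_two_left (n := m)).mpr hm
    exact_mod_cast Nat.isCoprime_iff_coprime.mpr this
  have h1 : (m:ℤ) ∣ 3 := by
    have hc : IsCoprime ((m:ℤ) + 2) ((2 ^ e * m : ℕ) : ℤ) := by
      push_cast
      refine IsCoprime.mul_right (IsCoprime.pow_right ?_) ?_
      · have := h2m.symm.add_mul_right_left 1
        simpa using this
      · have := (h2m.add_mul_right_left 1)
        rw [add_comm]; simpa using this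
    have h3 := (Dvd.intro_left (2 ^ e : ℤ) (by push_cast; rfl) : (m:ℤ) ∣ ((2 ^ e * m : ℕ) : ℤ)).trans (h _ hc)
    have h4 : ((m:ℤ) + 2) ^ 2 - 1 = m * (m + 4) + 3 := by ring
    rw [h4] at h3
    exact (dvd_add_right (Dvd.intro _ rfl)).mp h3
  have h3 : m ∣ 3 := by exact_mod_cast h1
  rcases (Nat.dvd_prime Nat.prime_three).mp h3 with rfl | rfl
  · have := h 3 (by push_cast; rw [mul_one]; exact IsCoprime.pow_right ⟨1, -1, by norm_num⟩)
    have h5 : ((2 ^ e * 1 : ℕ):ℤ) ∣ (24:ℕ) := this.trans ⟨3, by norm_num⟩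
    exact_mod_cast h5
  · have := h 5 (by
      push_cast
      exact IsCoprime.mul_right (IsCoprime.pow_right ⟨1, -2, by norm_num⟩) ⟨-1, 2, by norm_num⟩)
    norm_num at this
    exact_mod_cast this

lemma lift_coprime (r N : ℕ) [NeZero N] (hr : r ∣ N) (a : ℤ) (ha : IsCoprime a (r:ℤ)) :
    ∃ b : ℤ, IsCoprime b (N:ℤ) ∧ (r:ℤ) ∣ b - a := by
  obtain ⟨u, hu⟩ := ZMod.unitsMap_surjective hr (ZMod.unitOfIsCoprime a ha)
  have h1 := congrArg Units.val hu
  rw [ZMod.unitsMap_val] at h1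
  refine ⟨((u : ZMod N).val : ℤ), ?_, ?_⟩
  · exact Nat.isCoprime_iff_coprime.mpr (ZMod.val_coe_unit_coprime u)
  · rw [← ZMod.intCast_zmod_eq_zero_iff_dvd]
    push_cast
    rw [ZMod.natCast_val, h1]
    simp

/-- arithmetic of the normalizer -/
lemma normalizer_arith (N : ℕ) [NeZero N] (s : ℕ) (hs24 : s ∣ 24) (hs2 : s ^ 2 ∣ N)
    (hsmax : ∀ t : ℕ, t ∣ 24 → t ^ 2 ∣ N → t ≤ s) (h : SL(2, ℤ))
    (hn : ∀ γ ∈ Gamma0 N, h * γ * h⁻¹ ∈ Gamma0 N) :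
    IsCoprime (h 1 1) (N:ℤ) ∧ (N:ℤ) ∣ s * h 1 0 := by
  have hdet : h 0 0 * h 1 1 - h 0 1 * h 1 0 = 1 := by
    have := h.det_coe
    rwa [Matrix.det_fin_two] at this
  set z := h 1 0 with hz
  set t := h 1 1 with ht
  have hentry : ∀ γ : SL(2, ℤ), (h * γ * h⁻¹) 1 0 =
      z * γ 0 0 * t + t ^ 2 * γ 1 0 - z ^ 2 * γ 0 1 - z * t * γ 1 1 := by
    intro γ
    rw [Matrix.SpecialLinearGroup.coe_mul, Matrix.SpecialLinearGroup.coe_mul,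
      Matrix.SpecialLinearGroup.coe_inv, Matrix.adjugate_fin_two]
    simp [Matrix.mul_apply, Fin.sum_univ_two]
    ring
  have hn' : ∀ γ : SL(2, ℤ), (N:ℤ) ∣ γ 1 0 →
      (N:ℤ) ∣ z * γ 0 0 * t + t ^ 2 * γ 1 0 - z ^ 2 * γ 0 1 - z * t * γ 1 1 := by
    intro γ hγ
    have := hn γ (by rwa [Gamma0_mem, ZMod.intCast_zmod_eq_zero_iff_dvd])
    rwa [Gamma0_mem, ZMod.intCast_zmod_eq_zero_iff_dvd, hentry] at this
  have hz2 : (N:ℤ) ∣ z ^ 2 := by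
    have := hn' ⟨!![1, 1; 0, 1], by simp⟩ (by simp)
    have e : z * 1 * t + t ^ 2 * 0 - z ^ 2 * 1 - z * t * 1 = - z ^ 2 := by ring
    have h2 : (N:ℤ) ∣ z * 1 * t + t ^ 2 * 0 - z ^ 2 * 1 - z * t * 1 := this
    rw [e, dvd_neg] at h2
    exact h2
  have hzt : IsCoprime t z := ⟨h 0 0, -h 0 1, by linarith⟩
  have htN : IsCoprime t (N:ℤ) := (hzt.pow_right (n := 2)).of_isCoprime_of_dvd_right hz2
  have hsq : ∀ a : ℤ, IsCoprime a (N:ℤ) → (N:ℤ) ∣ z * (a ^ 2 - 1) := by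
    intro a ha
    obtain ⟨d, b, hdb⟩ := ha
    have := hn' ⟨!![a, -b; N, d], by rw [Matrix.det_fin_two]; simp; linarith⟩ (by simp)
    simp at this
    have h2 : (N:ℤ) ∣ t * (z * (a ^ 2 - 1)) := by
      have e : t * (z * (a ^ 2 - 1)) = a * (z * a * t + t ^ 2 * N + z ^ 2 * b - z * t * d)
          - N * (a * t ^ 2) - z ^ 2 * (a * b) - z * t * b * N := by
        linear_combination (z * t) * hdb
      rw [e]
      exact dvd_sub (dvd_sub (dvd_sub (this.mul_left _) (Dvd.intro _ rfl)) (hz2.mul_right _))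
        (Dvd.intro_left _ rfl)
    exact htN.symm.dvd_of_dvd_mul_left h2
  refine ⟨htN, ?_⟩
  have hN0 : (N:ℤ) ≠ 0 := by exact_mod_cast NeZero.ne N
  obtain ⟨z', r', hcop, hzz, hNr⟩ := Int.exists_gcd_one (m := z) (n := (N:ℤ))
    (Int.gcd_pos_of_ne_zero_right _ hN0)
  set G := Int.gcd z N with hG
  have hGpos : 0 < G := Int.gcd_pos_of_ne_zero_right _ hN0
  have hG0 : (G:ℤ) ≠ 0 := by exact_mod_cast hGpos.ne'
  have hr0 : 0 ≤ r' := by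
    by_contra hneg
    push Not at hneg
    have : (0:ℤ) ≤ N := by positivity
    have hGp : (0:ℤ) < G := by exact_mod_cast hGpos
    nlinarith
  lift r' to ℕ using hr0 with r hr
  have hcop' : IsCoprime z' (r:ℤ) := Int.isCoprime_iff_gcd_eq_one.mpr hcop
  have hNr' : N = r * G := by exact_mod_cast hNr
  have hrne : r ≠ 0 := by
    rintro rfl
    simp at hNr
    exact hN0 (by exact_mod_cast hNr)
  have hr24 : r ∣ 24 := by
    apply dvd24 r hrne
    intro a ha
    obtain ⟨b, hb, hba⟩ := lift_coprime r N ⟨G, hNr'⟩ a ha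
    have h1 := hsq b hb
    rw [hzz, hNr] at h1
    have h2 : (r:ℤ) ∣ z' * (b ^ 2 - 1) := by
      have e : z' * (G:ℤ) * (b ^ 2 - 1) = (z' * (b ^ 2 - 1)) * G := by ring
      rw [e] at h1
      exact (mul_dvd_mul_iff_right hG0).mp h1
    have h3 := hcop'.symm.dvd_of_dvd_mul_left h2
    have e : a ^ 2 - 1 = (b ^ 2 - 1) - (b - a) * (b + a) := by ring
    rw [e]
    exact dvd_sub h3 (hba.mul_right _)
  have hrG : (r:ℤ) ∣ G := by
    rw [hzz, hNr] at hz2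
    have e : (z' * (G:ℤ)) ^ 2 = (z' ^ 2 * G) * G := by ring
    rw [e] at hz2
    have h2 := (mul_dvd_mul_iff_right hG0).mp hz2
    exact (hcop'.symm.pow_right (n := 2)).dvd_of_dvd_mul_left h2
  have hr2 : r ^ 2 ∣ N := by
    have : r ∣ G := by exact_mod_cast hrG
    rw [hNr', sq]
    exact mul_dvd_mul_left _ this
  have hrs : r ∣ s := by
    have h1 : Nat.lcm r s ≤ s := hsmax _ (Nat.lcm_dvd hr24 hs24) (by
      rw [← Nat.pow_lcm_pow]
      exact Nat.lcm_dvd hr2 hs2)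
    have hs0 : s ≠ 0 := by rintro rfl; simp at hs24
    have h2 : Nat.lcm r s = s := le_antisymm h1 (Nat.le_of_dvd (Nat.pos_of_ne_zero (Nat.lcm_ne_zero hrne hs0)) (Nat.dvd_lcm_right r s))
    rw [← h2]
    exact Nat.dvd_lcm_left r s
  obtain ⟨u, rfl⟩ := hrs
  refine ⟨u * z', ?_⟩
  rw [hNr, hzz]
  push_cast
  ring

lemma translate_of_fricke (N : ℕ) [NeZero N] (k : ℤ) (w : ℂ) (hw : w ≠ 0) (F G : ℍ → ℂ)
    (hF : FrickeEigen N k F w) (hG : FrickeEigen N k G w) (m : ℤ) (L : SL(2, ℤ))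
    (hL : L = ⟨!![1, 0; m, 1], by simp⟩) (h : F ∣[k] L = G) (τ τ₁ : ℍ)
    (hτ : (τ₁ : ℂ) = τ - m / N) : G τ = F τ₁ := by
  have hN : (N:ℂ) ≠ 0 := by exact_mod_cast NeZero.ne N
  have hNr : (0:ℝ) < N := by exact_mod_cast Nat.pos_of_neZero N
  have h0 := τ.ne_zero
  have h10 := τ₁.ne_zero
  have hex : ∀ τ : ℍ, ∃ τ' : ℍ, (τ' : ℂ) = -1 / ((N:ℂ) * τ) := by
    intro τ
    have h0 := τ.ne_zero
    refine ⟨⟨-1 / ((N:ℂ) * τ), ?_⟩, rfl⟩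
    have e : (-1 / ((N:ℂ) * τ)) = (-(τ:ℂ))⁻¹ / N := by field_simp
    rw [e, Complex.div_natCast_im]
    exact div_pos τ.im_inv_neg_coe_pos hNr
  obtain ⟨τ', hτ'⟩ := hex τ
  obtain ⟨τ₁', hτ₁'⟩ := hex τ₁
  have e1 := hG τ τ' hτ'
  have e2 := hF τ₁ τ₁' hτ₁'
  have hden : denom L τ' = τ₁ / τ := by
    rw [ModularGroup.denom_apply, hL]
    simp
    rw [hτ', hτ]
    field_simp
    ring
  have hsm : L • τ' = τ₁' := by
    ext
    rw [UpperHalfPlane.specialLinearGroup_apply, hL]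
    simp
    rw [hτ', hτ₁', hτ]
    have : (N:ℂ) * τ - m ≠ 0 := by
      have : (N:ℂ) * τ - m = N * τ₁ := by rw [hτ]; field_simp
      rw [this]
      exact mul_ne_zero hN h10
    have h4 : -((m:ℂ)) + N * τ ≠ 0 := by rwa [neg_add_eq_sub]
    field_simp
    ring
  have e3 : G τ' = F τ₁' * (τ₁ / τ : ℂ) ^ (-k) := by
    rw [← h, ModularForm.SL_slash_apply, hsm, hden]
  rw [e3] at e1
  apply mul_left_cancel₀ hw
  rw [← e1, ← e2, div_zpow]
  have : (τ:ℂ) ^ (-k) ≠ 0 := zpow_ne_zero _ h0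
  field_simp

lemma hasExpansion_translate (N : ℕ) [NeZero N] (F G : ℍ → ℂ) (c : ℕ → ℂ) (m : ℤ)
    (hF : HasExpansion 1 F c)
    (h : ∀ τ τ₁ : ℍ, (τ₁ : ℂ) = τ - m / N → G τ = F τ₁) :
    HasExpansion 1 G (fun n => c n * Complex.exp (2 * Real.pi * Complex.I * ((-(n * m) : ℤ) : ℂ) / N)) := by
  intro τ
  have hN : (N:ℂ) ≠ 0 := by exact_mod_cast NeZero.ne N
  let τ₁ : ℍ := ⟨τ - m / N, by
    have : ((m:ℂ) / N).im = 0 := by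
      rw [Complex.div_natCast_im]; simp
    rw [Complex.sub_im, this, sub_zero]
    exact τ.im_pos⟩
  have hτ₁ : (τ₁ : ℂ) = τ - m / N := rfl
  rw [h τ τ₁ hτ₁]
  convert hF τ₁ using 1
  funext n
  rw [mul_assoc, ← Complex.exp_add, hτ₁]
  congr 2
  push_cast
  field_simp
  ring

lemma normalizer_main (N : ℕ) [NeZero N] (k : ℤ)
    (s : ℕ) (hs24 : s ∣ 24) (hs2 : s ^ 2 ∣ N)
    (hsmax : ∀ t : ℕ, t ∣ 24 → t ^ 2 ∣ N → t ≤ s)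
    (w : ℂ) (hw : w ≠ 0)
    (f fσ : CuspForm (Gamma0 N) k)
    (hstabf : ∀ γ : SL(2, ℤ), ⇑f ∣[k] γ = ⇑f ↔ γ ∈ Gamma0 N)
    (hfW : FrickeEigen N k (⇑f) w) (hfW' : FrickeEigen N k (⇑fσ) w)
    (cf cσ : ℕ → ℂ) (hcf : HasExpansion 1 (⇑f) cf) (hcσ : HasExpansion 1 (⇑fσ) cσ)
    (n₀ : ℕ) (hn₀s : Nat.Coprime n₀ s) (hne : cf n₀ ≠ 0) (heq : cσ n₀ = cf n₀)
    (h : SL(2, ℤ)) (hh : ⇑f ∣[k] h = ⇑fσ) : h ∈ Gamma0 N := by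
  have hnorm : ∀ γ ∈ Gamma0 N, h * γ * h⁻¹ ∈ Gamma0 N := by
    intro γ hγ
    rw [← hstabf, SlashAction.slash_mul, SlashAction.slash_mul, hh, gamma0_slash fσ hγ, ← hh,
      ← SlashAction.slash_mul, mul_inv_cancel, SlashAction.slash_one]
  obtain ⟨ht, hz⟩ := normalizer_arith N s hs24 hs2 hsmax h hnorm
  obtain ⟨u, v, huv⟩ := ht
  let m : ℤ := u * h 1 0
  have hmt : (N:ℤ) ∣ h 1 0 - h 1 1 * m := ⟨v * h 1 0, by
    simp only [m]; linear_combination (- h 1 0) * huv⟩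
  let L : SL(2, ℤ) := ⟨!![1, 0; m, 1], by simp⟩
  have hγ : h * L⁻¹ ∈ Gamma0 N := by
    rw [Gamma0_mem, ZMod.intCast_zmod_eq_zero_iff_dvd]
    have : (h * L⁻¹) 1 0 = h 1 0 - h 1 1 * m := by
      rw [Matrix.SpecialLinearGroup.coe_mul, Matrix.SpecialLinearGroup.coe_inv, Matrix.adjugate_fin_two]
      simp [Matrix.mul_apply, Fin.sum_univ_two, L]
      ring
    rw [this]
    exact hmt
  have hfL : ⇑f ∣[k] L = ⇑fσ := by
    rw [← hh]
    conv_rhs => rw [show h = (h * L⁻¹) * L by group, SlashAction.slash_mul, gamma0_slash f hγ]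
  have hexp := hasExpansion_translate N f fσ cf m hcf
    (fun τ τ₁ hτ => translate_of_fricke N k w hw f fσ hfW hfW' m L rfl hfL τ τ₁ hτ)
  have hco := congrFun (hasExpansion_unique 1 hcσ hexp) n₀
  rw [heq] at hco
  have hone : Complex.exp (2 * Real.pi * Complex.I * ((-(n₀ * m) : ℤ) : ℂ) / N) =
      Complex.exp (2 * Real.pi * Complex.I * ((0:ℤ) : ℂ) / N) := by
    have h1 := mul_left_cancel₀ hne ((mul_one _).trans hco)
    rw [← h1]
    simp
  have hd := exp_eq_of N (Nat.pos_of_neZero N) _ _ hone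
  rw [sub_zero, dvd_neg] at hd
  have hsm : (N:ℤ) ∣ s * m := by
    have : (s:ℤ) * m = u * (s * h 1 0) := by simp only [m]; ring
    rw [this]
    exact hz.mul_left _
  have hm : (N:ℤ) ∣ m := by
    obtain ⟨x, y, hxy⟩ := Nat.isCoprime_iff_coprime.mpr hn₀s
    have : m = x * (n₀ * m) + y * (s * m) := by linear_combination (-m) * hxy
    rw [this]
    exact dvd_add (hd.mul_left _) (hsm.mul_left _)
  rw [Gamma0_mem, ZMod.intCast_zmod_eq_zero_iff_dvd]
  have : h 1 0 = (h 1 0 - h 1 1 * m) + h 1 1 * m := by ring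
  rw [this]
  exact dvd_add hmt (hm.mul_left _)

end Part7

section Part8

lemma arith_final (N : ℕ) [NeZero N] (g g' : SL(2, ℤ)) (l : ℕ) (μ : ℤ)
    (hμ : (N:ℤ) ∣ μ * l - 1)
    (hc : (N:ℤ) ∣ g' 1 0 - μ * g 1 0) (hd : (N:ℤ) ∣ g' 1 1 - g 1 1) (N' : ℕ)
    (hN' : N' = N / Int.gcd (g 1 0 * g 1 1) N) :
    Int.gcd (g 1 0 * g 1 1) N * N' = N ∧
    (g * g'⁻¹ ∈ Gamma0 N ↔ (N' : ℤ) ∣ l - 1) := by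
  have hN0 : (N:ℤ) ≠ 0 := by exact_mod_cast NeZero.ne N
  obtain ⟨e, r', hcop, hzz, hNr⟩ := Int.exists_gcd_one (m := g 1 0 * g 1 1) (n := (N:ℤ))
    (Int.gcd_pos_of_ne_zero_right _ hN0)
  have hdN : Int.gcd (g 1 0 * g 1 1) N ∣ N := by
    exact_mod_cast Int.gcd_dvd_right (g 1 0 * g 1 1) (N:ℤ)
  have hmul : Int.gcd (g 1 0 * g 1 1) N * N' = N := by rw [hN', Nat.mul_div_cancel' hdN]
  refine ⟨hmul, ?_⟩
  set G := Int.gcd (g 1 0 * g 1 1) N with hG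
  have hGpos : 0 < G := Int.gcd_pos_of_ne_zero_right _ hN0
  have hG0 : (G:ℤ) ≠ 0 := by exact_mod_cast hGpos.ne'
  have hmul' : (N:ℤ) = N' * G := by rw [mul_comm]; exact_mod_cast hmul.symm
  have hr : r' = N' := mul_right_cancel₀ hG0 (hNr.symm.trans hmul')
  subst hr
  have hcop' : IsCoprime e (N':ℤ) := Int.isCoprime_iff_gcd_eq_one.mpr hcop
  have hN'N : (N':ℤ) ∣ N := ⟨G, hmul'⟩
  have hent : (g * g'⁻¹) 1 0 = g 1 0 * g' 1 1 - g' 1 0 * g 1 1 := by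
    rw [Matrix.SpecialLinearGroup.coe_mul, Matrix.SpecialLinearGroup.coe_inv, Matrix.adjugate_fin_two]
    simp [Matrix.mul_apply, Fin.sum_univ_two]
    ring
  rw [Gamma0_mem, ZMod.intCast_zmod_eq_zero_iff_dvd, hent]
  have e1 : g 1 0 * g' 1 1 - g' 1 0 * g 1 1 =
      (g 1 0 * (g' 1 1 - g 1 1) - (g' 1 0 - μ * g 1 0) * g 1 1) + g 1 0 * g 1 1 * (1 - μ) := by ring
  rw [e1, dvd_add_right (dvd_sub (hd.mul_left _) (hc.mul_right _)), hzz,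
    show e * (G:ℤ) * (1 - μ) = (e * (1 - μ)) * G by ring]
  have e2 : (N:ℤ) ∣ e * (1 - μ) * G ↔ (N':ℤ) ∣ 1 - μ := by
    conv_lhs => rw [hmul']
    rw [mul_dvd_mul_iff_right hG0]
    exact ⟨fun h => hcop'.symm.dvd_of_dvd_mul_left h, fun h => h.mul_left _⟩
  rw [e2]
  have h3 := hN'N.trans hμ
  constructor
  · intro h
    have : (l:ℤ) - 1 = (1 - μ) * l + (μ * l - 1) := by ring
    rw [this]
    exact dvd_add (h.mul_right _) h3
  · intro h
    have : 1 - μ = μ * (l - 1) - (μ * l - 1) := by ring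
    rw [this]
    exact dvd_sub (h.mul_left _) h3

lemma zero_coeff_cusp {N : ℕ} [NeZero N] {k : ℤ} (f : CuspForm (Gamma0 N) k) (c : ℕ → ℂ)
    (h : HasExpansion 1 f c) : c 0 = 0 := by
  refine hasExpansion_zero_coeff 1 h ?_
  have := CuspFormClass.zero_at_infty_slash f 1
  rwa [SlashAction.slash_one] at this

end Part8

/-- Let `s` be the largest divisor of `24` with `s² ∣ N`, `w ∈ {±1}`, and
let `f` be a cusp form of weight `k ≥ 2` on `Γ₀(N)` with stabiliser exactly `Γ₀(N)`, a
`W_N`-eigenvector with eigenvalue `w`, having a nonzero rational coefficient `a_{n₀}(f)`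
with `n₀` coprime to `s`, and such that every `Aut(ℂ)`-conjugate of `f` is again such a
cusp form. Then for every `g = (A,B;C,D) ∈ SL₂(ℤ)`, the subfield of `ℂ` generated by the
Fourier coefficients of `f|_k g` equals `K_f(ζ_{N'})`, `N' = N/gcd(CD,N)`. -/
theorem stmt_17 (N : ℕ) (hN : 1 ≤ N) (k : ℤ) (hk : 2 ≤ k)
    (s : ℕ) (hs24 : s ∣ 24) (hs2 : s ^ 2 ∣ N)
    (hsmax : ∀ t : ℕ, t ∣ 24 → t ^ 2 ∣ N → t ≤ s)
    (w : ℂ) (hw : w = 1 ∨ w = -1)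
    (f : CuspForm (Gamma0 N) k)
    (hstabf : ∀ γ : SL(2, ℤ), ⇑f ∣[k] γ = ⇑f ↔ γ ∈ Gamma0 N)
    (hfW : FrickeEigen N k (⇑f) w)
    (cf : ℕ → ℂ) (hcf : HasExpansion 1 (⇑f) cf)
    (n₀ : ℕ) (hn₀ : 1 ≤ n₀) (hn₀s : Nat.Coprime n₀ s)
    (hrat : ∃ q : ℚ, q ≠ 0 ∧ cf n₀ = (q : ℂ))
    (hconj : ∀ σ : ℂ ≃+* ℂ, ∃ (fσ : CuspForm (Gamma0 N) k) (cσ : ℕ → ℂ),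
      HasExpansion 1 (⇑fσ) cσ ∧ (∀ n : ℕ, 1 ≤ n → cσ n = σ (cf n)) ∧
      (∀ γ : SL(2, ℤ), ⇑fσ ∣[k] γ = ⇑fσ ↔ γ ∈ Gamma0 N) ∧
      FrickeEigen N k (⇑fσ) w) :
    ∀ g : SL(2, ℤ), ∀ N' : ℕ, N' = N / Int.gcd (g 1 0 * g 1 1) N →
      ∀ c : ℕ → ℂ, HasExpansion N (⇑f ∣[k] g) c →
        Subfield.closure (Set.range c) =
          Subfield.closure ({x : ℂ | ∃ j : ℕ, 1 ≤ j ∧ x = cf j} ∪ {zetaC N'}) := by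
  intro g N' hN' c hc
  have : NeZero N := ⟨by omega⟩
  have hw0 : w ≠ 0 := by rcases hw with rfl | rfl <;> simp
  obtain ⟨q, hq, hcq⟩ := hrat
  apply le_antisymm
  · rw [Subfield.closure_le]
    rintro _ ⟨n, rfl⟩
    by_contra hmem
    obtain ⟨σ, hfix, hmove⟩ := exists_aut_move _ _ hmem
    apply hmove
    obtain ⟨fσ, cσ, hcσ, hcc, -, -⟩ := hconj σ
    obtain ⟨l, μ, hσ, hcop, hμ⟩ := aut_zeta N σ
    obtain ⟨g', hg1, hg2⟩ := exists_twist N μ hcop g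
    obtain ⟨hmul, hiff⟩ := arith_final N g g' l μ hμ hg1 hg2 N' hN'
    have hcc' : cσ = cf := by
      funext j
      rcases Nat.eq_zero_or_pos j with rfl | hj
      · rw [zero_coeff_cusp f cf hcf, zero_coeff_cusp fσ cσ hcσ]
      · rw [hcc j hj]
        exact hfix _ (Subfield.subset_closure (Or.inl ⟨j, hj, rfl⟩))
    have hff : (⇑fσ : ℍ → ℂ) = f := hasExpansion_fun_unique 1 hcσ (hcc' ▸ hcf)
    have hz : σ (zetaC N') = zetaC N' := hfix _ (Subfield.subset_closure (Or.inr rfl))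
    have hmemG := hiff.mpr ((aut_zeta_div N N' _ hmul σ l hσ).mp hz)
    have hfg : ⇑f ∣[k] g' = ⇑f ∣[k] g := by
      conv_rhs => rw [show g = (g * g'⁻¹) * g' by group, SlashAction.slash_mul, gamma0_slash f hmemG]
    have h1 := galois_slash f fσ σ cf cσ hcf hcσ hcc l μ hcop hμ hσ g g' hg1 hg2 c hc
    rw [hff, hfg] at h1
    exact congrFun (hasExpansion_unique N h1 hc) n
  · rw [Subfield.closure_le]
    intro x hx
    by_contra hmem
    obtain ⟨σ, hfix, hmove⟩ := exists_aut_move _ _ hmem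
    apply hmove
    obtain ⟨fσ, cσ, hcσ, hcc, -, hfW'⟩ := hconj σ
    obtain ⟨l, μ, hσ, hcop, hμ⟩ := aut_zeta N σ
    obtain ⟨g', hg1, hg2⟩ := exists_twist N μ hcop g
    obtain ⟨hmul, hiff⟩ := arith_final N g g' l μ hμ hg1 hg2 N' hN'
    have h1 := galois_slash f fσ σ cf cσ hcf hcσ hcc l μ hcop hμ hσ g g' hg1 hg2 c hc
    have h2 : (fun n => σ (c n)) = c := by
      funext n
      exact hfix _ (Subfield.subset_closure ⟨n, rfl⟩)
    rw [h2] at h1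
    have h3 : ⇑fσ ∣[k] g' = ⇑f ∣[k] g := hasExpansion_fun_unique N h1 hc
    have h4 : ⇑f ∣[k] (g * g'⁻¹) = ⇑fσ := by
      rw [SlashAction.slash_mul, ← h3, ← SlashAction.slash_mul, mul_inv_cancel, SlashAction.slash_one]
    have hmemG : g * g'⁻¹ ∈ Gamma0 N := by
      refine normalizer_main N k s hs24 hs2 hsmax w hw0 f fσ hstabf hfW hfW' cf cσ hcf hcσ n₀ hn₀s
        ?_ ?_ _ h4
      · rw [hcq]
        exact_mod_cast hq
      · rw [hcc n₀ hn₀, hcq, map_ratCast]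
    rcases hx with ⟨j, hj, rfl⟩ | hx
    · rw [gamma0_slash f hmemG] at h4
      rw [← hcc j hj]
      rw [← h4] at hcσ
      exact congrFun (hasExpansion_unique 1 hcσ hcf) j
    · rw [Set.mem_singleton_iff] at hx
      rw [hx]
      exact (aut_zeta_div N N' _ hmul σ l hσ).mpr (hiff.mp hmemG)
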